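/- arXiv:2005.03397 — 2 statements merged into one kernel-verified Lean document; each statement's English description precedes it below -/
import Mathlib

section
/- Let n ≥ 1. There is a constant C depending only on n such that the following holds. Let μ be a positive Borel measure on ℝ^{n+1} with upper parabolic growth of degree n+1 with constant 1, i.e. μ(B_p(x̄,r)) ≤ r^{n+1} for all x̄ ∈ ℝ^{n+1} and r > 0, and assume ‖∇_x W * μ‖_∞ ≤ 1. Then ‖∂_t^{1/2}(W * μ)‖_{*,p} ≤ C. -/
open MeasureTheory Real Set

noncomputable section

/-- The spatial factor `ℝⁿ`. -/
abbrev Spc (n : ℕ) := EuclideanSpace ℝ (Fin n)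

/-- The parabolic space `ℝ^{n+1} = ℝⁿ × ℝ`, points `x̄ = (x, t)`. -/
abbrev Pt (n : ℕ) := Spc n × ℝ

/-- The parabolic norm `|x̄|_p = max (|x|, |t|^{1/2})`. -/
def pnorm {n : ℕ} (p : Pt n) : ℝ := max ‖p.1‖ (Real.sqrt |p.2|)

/-- The parabolic ball of center `c` and radius `r`. -/
def pball {n : ℕ} (c : Pt n) (r : ℝ) : Set (Pt n) := {p | pnorm (p - c) < r}

/-- The heat kernel `W`. -/
def heatW {n : ℕ} (p : Pt n) : ℝ :=
  if 0 < p.2 then (4 * π * p.2) ^ (-(n : ℝ) / 2) * Real.exp (-‖p.1‖ ^ 2 / (4 * p.2)) else 0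

/-- The spatial gradient `∇ₓ W` of the heat kernel. -/
def gradW {n : ℕ} (p : Pt n) : Spc n :=
  if 0 < p.2 then
    (-(1 / (2 * p.2)) * (4 * π * p.2) ^ (-(n : ℝ) / 2) * Real.exp (-‖p.1‖ ^ 2 / (4 * p.2))) • p.1
  else 0

/-- Half time derivative `∂_t^{1/2} f (x,t) = ∫ (f(x,s) - f(x,t))/|s-t|^{3/2} ds`. -/
def halfT {n : ℕ} (f : Pt n → ℝ) (p : Pt n) : ℝ :=
  ∫ s : ℝ, (f (p.1, s) - f p) / |s - p.2| ^ (3 / 2 : ℝ)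

/-- A parabolic cube: product of `n` intervals of length `len` and a time interval
of length `len ^ 2`. -/
structure PCube (n : ℕ) where
  corner : Fin n → ℝ
  time : ℝ
  len : ℝ
  len_pos : 0 < len

/-- The set of points of a parabolic cube. -/
def PCube.toSet {n : ℕ} (Q : PCube n) : Set (Pt n) :=
  {p | (∀ i, p.1 i ∈ Set.Icc (Q.corner i) (Q.corner i + Q.len)) ∧
    p.2 ∈ Set.Icc Q.time (Q.time + Q.len ^ 2)}

/-- The dilation `λQ` of a parabolic cube: same center, side lengths `λ·len` and
`λ²·len²`. -/
def PCube.dilate {n : ℕ} (Q : PCube n) (lam : ℝ) (h : 0 < lam) : PCube n :=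
  ⟨fun i => Q.corner i + Q.len / 2 - lam * Q.len / 2,
    Q.time + Q.len ^ 2 / 2 - lam ^ 2 * Q.len ^ 2 / 2,
    lam * Q.len, mul_pos h Q.len_pos⟩

/-- Second directional derivative in the `i`-th spatial direction. -/
def dir2 {n : ℕ} (φ : Pt n → ℝ) (p : Pt n) (i : Fin n) : ℝ :=
  deriv (fun h : ℝ =>
    deriv (fun h' : ℝ => φ (p.1 + h' • (EuclideanSpace.single i 1 : Spc n), p.2)) h) 0

/-- Spatial Laplacian `Δₓ φ`. -/
def lapx {n : ℕ} (φ : Pt n → ℝ) (p : Pt n) : ℝ := ∑ i : Fin n, dir2 φ p i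

/-- A `C²` function `φ` is admissible for a parabolic cube `Q` if it is supported on `Q`,
`‖∇ₓ φ‖_∞ ≤ 1/ℓ(Q)` and `‖Δₓ φ‖_∞ + ‖∂_t φ‖_∞ ≤ 1/ℓ(Q)²`. -/
def Admissible {n : ℕ} (φ : Pt n → ℝ) (Q : PCube n) : Prop :=
  ContDiff ℝ 2 φ ∧ tsupport φ ⊆ Q.toSet ∧
  (∀ p : Pt n, ‖fderiv ℝ (fun y : Spc n => φ (y, p.2)) p.1‖ ≤ 1 / Q.len) ∧
  (∀ p : Pt n, |lapx φ p| + |deriv (fun s : ℝ => φ (p.1, s)) p.2| ≤ 1 / Q.len ^ 2)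

/-- The parabolic BMO norm of `f` is at most `C`. -/
def ParabBMOLe {n : ℕ} (f : Pt n → ℝ) (C : ℝ) : Prop :=
  ∀ Q : PCube n, ⨍ p in Q.toSet, |f p - ⨍ q in Q.toSet, f q| ≤ C

/-- `‖F‖_{Lip_{1/2,t}} ≤ C` : half-Lipschitz in time. -/
def LipHalfLe {n : ℕ} (F : Pt n → ℝ) (C : ℝ) : Prop :=
  ∀ (x : Spc n) (t u : ℝ), |F (x, t) - F (x, u)| ≤ C * Real.sqrt |t - u|

/-- Integral of a scalar function against a finite signed measure. -/
def sInt {n : ℕ} (ν : SignedMeasure (Pt n)) (f : Pt n → ℝ) : ℝ :=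
  ∫ y, f y ∂ν.toJordanDecomposition.posPart - ∫ y, f y ∂ν.toJordanDecomposition.negPart

/-- Integral of a vector-valued function against a finite signed measure. -/
def vInt {n : ℕ} (ν : SignedMeasure (Pt n)) (f : Pt n → Spc n) : Spc n :=
  ∫ y, f y ∂ν.toJordanDecomposition.posPart - ∫ y, f y ∂ν.toJordanDecomposition.negPart

/-- `W * ν`. -/
def convW {n : ℕ} (ν : SignedMeasure (Pt n)) (p : Pt n) : ℝ :=
  sInt ν (fun y => heatW (p - y))

/-- `∇ₓ W * ν`. -/
def convGradW {n : ℕ} (ν : SignedMeasure (Pt n)) (p : Pt n) : Spc n :=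
  vInt ν (fun y => gradW (p - y))

/-- `W * (φ ν)`, where `φν` is the measure with density `φ` w.r.t. `ν`. -/
def convWd {n : ℕ} (ν : SignedMeasure (Pt n)) (φ : Pt n → ℝ) (p : Pt n) : ℝ :=
  sInt ν (fun y => φ y * heatW (p - y))

/-- `∇ₓ W * (φ ν)`. -/
def convGradWd {n : ℕ} (ν : SignedMeasure (Pt n)) (φ : Pt n → ℝ) (p : Pt n) : Spc n :=
  vInt ν (fun y => φ y • gradW (p - y))

/-- `W * μ` for a positive measure `μ`. -/
def mconvW {n : ℕ} (μ : Measure (Pt n)) (p : Pt n) : ℝ := ∫ y, heatW (p - y) ∂μ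

/-- `∇ₓ W * μ` for a positive measure `μ`. -/
def mconvGradW {n : ℕ} (μ : Measure (Pt n)) (p : Pt n) : Spc n := ∫ y, gradW (p - y) ∂μ

/-- Upper parabolic growth of degree `n+1` with constant `1`. -/
def PGrowth {n : ℕ} (μ : Measure (Pt n)) : Prop :=
  ∀ (c : Pt n) (r : ℝ), 0 < r → μ (pball c r) ≤ ENNReal.ofReal (r ^ (n + 1))



lemma pnorm_nonneg {n : ℕ} (p : Pt n) : 0 ≤ pnorm p := le_max_of_le_left (norm_nonneg _)

lemma norm_le_pnorm {n : ℕ} (p : Pt n) : ‖p.1‖ ≤ pnorm p := le_max_left _ _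

lemma sqrt_le_pnorm {n : ℕ} (p : Pt n) : √|p.2| ≤ pnorm p := le_max_right _ _

lemma abs_le_pnorm_sq {n : ℕ} (p : Pt n) : |p.2| ≤ pnorm p ^ 2 := by
  have := sqrt_le_pnorm p
  rw [Real.sqrt_le_left (pnorm_nonneg p)] at this
  exact this

lemma pnorm_le {n : ℕ} {p : Pt n} {r : ℝ} (hr : 0 ≤ r) (h1 : ‖p.1‖ ≤ r) (h2 : |p.2| ≤ r ^ 2) :
    pnorm p ≤ r := max_le h1 ((Real.sqrt_le_left hr).2 h2)

lemma pnorm_neg {n : ℕ} (p : Pt n) : pnorm (-p) = pnorm p := by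
  simp [pnorm]

lemma pnorm_sub_comm {n : ℕ} (p q : Pt n) : pnorm (p - q) = pnorm (q - p) := by
  rw [← pnorm_neg, neg_sub]

lemma pnorm_add_le {n : ℕ} (p q : Pt n) : pnorm (p + q) ≤ pnorm p + pnorm q := by
  have hp := pnorm_nonneg p
  have hq := pnorm_nonneg q
  apply pnorm_le (by positivity)
  · exact (norm_add_le _ _).trans (add_le_add (norm_le_pnorm p) (norm_le_pnorm q))
  · have := abs_add_le p.2 q.2
    have h1 := abs_le_pnorm_sq p
    have h2 := abs_le_pnorm_sq q
    simp only [Prod.snd_add]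
    nlinarith [mul_nonneg hp hq]

lemma pnorm_sub_le {n : ℕ} (p q r : Pt n) : pnorm (p - r) ≤ pnorm (p - q) + pnorm (q - r) := by
  have := pnorm_add_le (p - q) (q - r)
  rwa [sub_add_sub_cancel] at this

@[fun_prop]
lemma continuous_pnorm {n : ℕ} : Continuous (pnorm (n := n)) := by
  unfold pnorm; fun_prop

@[fun_prop]
lemma measurable_pnorm {n : ℕ} : Measurable (pnorm (n := n)) := continuous_pnorm.measurable

lemma measurableSet_pball {n : ℕ} (c : Pt n) (r : ℝ) : MeasurableSet (pball c r) := by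
  unfold pball
  exact measurableSet_lt (by fun_prop) measurable_const

lemma pnorm_pos_of {n : ℕ} {p : Pt n} (h : 0 < p.2) : 0 < pnorm p :=
  lt_of_lt_of_le (Real.sqrt_pos.2 (abs_pos.2 h.ne')) (sqrt_le_pnorm p)

lemma heatW_nonpos {n : ℕ} {p : Pt n} (h : p.2 ≤ 0) : heatW p = 0 := by
  simp [heatW, not_lt.2 h]

lemma heatW_eq {n : ℕ} {p : Pt n} (h : 0 < p.2) :
    heatW p = (4 * π * p.2) ^ (-(n : ℝ) / 2) * Real.exp (-‖p.1‖ ^ 2 / (4 * p.2)) := by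
  simp [heatW, h]

lemma heatW_nonneg {n : ℕ} (p : Pt n) : 0 ≤ heatW p := by
  unfold heatW
  split_ifs with h
  · positivity
  · exact le_rfl

@[fun_prop]
lemma measurable_heatW {n : ℕ} : Measurable (heatW (n := n)) := by
  unfold heatW
  apply Measurable.ite (measurableSet_lt measurable_const measurable_snd)
  · fun_prop
  · fun_prop

@[fun_prop]
lemma measurable_gradW {n : ℕ} : Measurable (gradW (n := n)) := by
  unfold gradW
  apply Measurable.ite (measurableSet_lt measurable_const measurable_snd)
  · fun_prop
  · fun_prop

lemma norm_gradW {n : ℕ} {p : Pt n} (h : 0 < p.2) :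
    ‖gradW p‖ = ‖p.1‖ / (2 * p.2) * heatW p := by
  rw [heatW_eq h]
  simp only [gradW, h, if_true, norm_smul, norm_mul, norm_neg]
  rw [Real.norm_of_nonneg (by positivity), Real.norm_of_nonneg (by positivity),
    Real.norm_of_nonneg (by positivity)]
  ring

lemma gradW_nonpos {n : ℕ} {p : Pt n} (h : p.2 ≤ 0) : gradW p = 0 := by
  simp [gradW, not_lt.2 h]

/-- Master bound for the heat kernel. -/
lemma heatW_bound (n : ℕ) : ∃ C : ℝ, 0 < C ∧ ∀ p : Pt n, 0 < p.2 →
    heatW p ≤ C * p.2 ^ 2 / pnorm p ^ (n + 4) := by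
  refine ⟨4 ^ (n+4) * (n+4).factorial, by positivity, ?_⟩
  intro p hp
  have hP := pnorm_pos_of hp
  set q := √p.2 with hq
  have hq0 : 0 < q := Real.sqrt_pos.2 hp
  have hqq : q ^ 2 = p.2 := Real.sq_sqrt hp.le
  have key : Real.exp (-‖p.1‖ ^ 2 / (4 * p.2)) * (pnorm p / q) ^ (n+4)
      ≤ 4 ^ (n+4) * (n+4).factorial := by
    by_cases hc : ‖p.1‖ ≤ q
    · have : pnorm p = q := by
        unfold pnorm; rw [abs_of_pos hp]; exact max_eq_right hc
      rw [this, div_self hq0.ne', one_pow, mul_one]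
      have h1 : Real.exp (-‖p.1‖ ^ 2 / (4 * p.2)) ≤ 1 := by
        apply Real.exp_le_one_iff.2
        apply div_nonpos_of_nonpos_of_nonneg <;> nlinarith [sq_nonneg ‖p.1‖]
      have h2 : (1:ℝ) ≤ 4 ^ (n+4) := one_le_pow₀ (by norm_num)
      have h3 : (1:ℝ) ≤ (n+4).factorial := by exact_mod_cast Nat.one_le_iff_ne_zero.2 (Nat.factorial_ne_zero _)
      nlinarith
    · push Not at hc
      have : pnorm p = ‖p.1‖ := by
        unfold pnorm; rw [abs_of_pos hp]; exact max_eq_left hc.le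
      rw [this]
      have h1 : 1 ≤ ‖p.1‖ / q := (one_le_div hq0).2 hc.le
      have h2 : (‖p.1‖ / q) ^ (n+4) ≤ ((‖p.1‖ / q)^2) ^ (n+4) := by
        gcongr; nlinarith
      have h3 : (‖p.1‖ / q)^2 = 4 * (‖p.1‖^2 / (4 * p.2)) := by
        rw [div_pow, hqq]; field_simp
      have h4 := Real.pow_div_factorial_le_exp (‖p.1‖^2 / (4 * p.2)) (by positivity) (n+4)
      rw [h3, mul_pow] at h2
      rw [div_le_iff₀ (by positivity)] at h4
      calc _ ≤ Real.exp (-‖p.1‖ ^ 2 / (4 * p.2)) * (4 ^ (n+4) * (‖p.1‖^2 / (4 * p.2)) ^ (n+4)) := by gcongr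
        _ ≤ Real.exp (-‖p.1‖ ^ 2 / (4 * p.2)) * (4 ^ (n+4) * (Real.exp (‖p.1‖^2 / (4 * p.2)) * (n+4).factorial)) := by gcongr
        _ = (Real.exp (-‖p.1‖ ^ 2 / (4 * p.2)) * Real.exp (‖p.1‖^2 / (4 * p.2))) * (4 ^ (n+4) * (n+4).factorial) := by ring
        _ = _ := by rw [← Real.exp_add, neg_div, neg_add_cancel, Real.exp_zero, one_mul]
  have hpow : (4 * π * p.2) ^ (-(n : ℝ) / 2) ≤ 1 / q ^ n := by
    have h1 : (4 * π * p.2) ^ (-(n : ℝ) / 2) ≤ p.2 ^ (-(n : ℝ) / 2) := by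
      apply Real.rpow_le_rpow_of_nonpos hp
      · nlinarith [Real.pi_gt_three]
      · apply div_nonpos_of_nonpos_of_nonneg <;> simp
    refine h1.trans (le_of_eq ?_)
    rw [neg_div, Real.rpow_neg hp.le, ← Real.rpow_natCast q n, hq, Real.sqrt_eq_rpow, ← Real.rpow_mul hp.le]
    rw [one_div]; congr 2; ring
  rw [heatW_eq hp, le_div_iff₀ (by positivity)]
  have e : pnorm p ^ (n+4) = (pnorm p / q)^(n+4) * q^(n+4) := by
    rw [div_pow]; field_simp
  calc _ ≤ (1 / q ^ n) * Real.exp (-‖p.1‖ ^ 2 / (4 * p.2)) * ((pnorm p / q)^(n+4) * q^(n+4)) := by rw [e]; gcongr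
    _ = (Real.exp (-‖p.1‖ ^ 2 / (4 * p.2)) * (pnorm p / q) ^ (n+4)) * q^4 := by
        rw [pow_add q]; field_simp
    _ ≤ (4 ^ (n+4) * (n+4).factorial) * q^4 := by gcongr
    _ = _ := by rw [← hqq]; ring

/-- `W ≤ C |p|^{-n}`. -/
lemma heatW_le_pow (n : ℕ) : ∃ C : ℝ, 0 < C ∧ ∀ p : Pt n,
    heatW p ≤ C * (pnorm p)⁻¹ ^ n := by
  obtain ⟨C, hC, h⟩ := heatW_bound n
  refine ⟨C, hC, fun p => ?_⟩
  have := pnorm_nonneg p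
  rcases le_or_gt p.2 0 with hp | hp
  · rw [heatW_nonpos hp]; positivity
  · refine (h p hp).trans ?_
    have hP := pnorm_pos_of hp
    have := abs_le_pnorm_sq p
    rw [abs_of_pos hp] at this
    rw [inv_pow, ← div_eq_mul_inv, div_le_div_iff₀ (by positivity) (by positivity), pow_add]
    have : p.2 ^ 2 ≤ pnorm p ^ 4 := by
      calc p.2^2 ≤ (pnorm p ^ 2)^2 := by gcongr
        _ = _ := by ring
    calc C * p.2 ^ 2 * pnorm p ^ n ≤ C * pnorm p ^ 4 * pnorm p ^ n := by gcongr
      _ = _ := by ring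

/-- Time comparison: `W(x,t) ≥ (s/t)^n' W(x,s)`. -/
lemma heatW_time_mono {n : ℕ} (x : Spc n) {s t : ℝ} (hs : 0 < s) (hst : s < t) :
    (s / t) ^ ((n : ℝ) / 2) * heatW (x, s) ≤ heatW (x, t) := by
  have ht := hs.trans hst
  rw [heatW_eq (p := (x, s)) hs, heatW_eq (p := (x, t)) ht]
  simp only
  rw [← mul_assoc]
  have e : (s / t) ^ ((n : ℝ) / 2) * (4 * π * s) ^ (-(n : ℝ) / 2) = (4 * π * t) ^ (-(n : ℝ) / 2) := by
    have : 4 * π * t = 4 * π * s * (s / t)⁻¹ := by field_simp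
    rw [this, Real.mul_rpow (x := 4 * π * s) (y := (s / t)⁻¹) (by positivity) (by positivity), Real.inv_rpow (by positivity),
      neg_div, Real.rpow_neg (x := s / t) (by positivity), inv_inv, mul_comm]
  rw [e]
  gcongr ?_ * Real.exp ?_
  rw [neg_div, neg_div, neg_le_neg_iff]
  gcongr

lemma one_sub_rpow_le {n : ℕ} {s t : ℝ} (hs : 0 < s) (hst : s < t) :
    1 - (s / t) ^ ((n : ℝ) / 2) ≤ n * ((t - s) / t) := by
  have ht := hs.trans hst
  have h1 : (s/t)^n ≤ (s / t) ^ ((n : ℝ) / 2) := by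
    rw [← Real.rpow_natCast]
    apply Real.rpow_le_rpow_of_exponent_ge (by positivity) ((div_le_one ht).2 hst.le)
    have : (0:ℝ) ≤ n := by positivity
    linarith
  have h0 : 0 < s / t := by positivity
  have h2 := one_add_mul_le_pow (a := -((t-s)/t)) (by
    have : (t - s)/t ≤ 1 := by rw [div_le_one ht]; linarith
    linarith) n
  have h3 : 1 + -((t-s)/t) = s / t := by field_simp; ring
  rw [h3] at h2
  linarith

lemma heatW_diff_aux (n : ℕ) : ∃ C : ℝ, 0 < C ∧ ∀ (x : Spc n) (s t : ℝ), s < t →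
    2 * (t - s) ≤ pnorm (x, t) ^ 2 →
    |heatW (x, t) - heatW (x, s)| ≤ C * (t - s) * (pnorm (x, t))⁻¹ ^ (n + 2) := by
  obtain ⟨C, hC, h⟩ := heatW_bound n
  refine ⟨C * (2 + n * 2 ^ (n + 2)), by positivity, ?_⟩
  intro x s t hst hd
  have hP0 := pnorm_nonneg (x, t)
  rcases le_or_gt t 0 with ht | ht
  · rw [heatW_nonpos (p := (x, t)) ht, heatW_nonpos (p := (x, s)) (hst.le.trans ht)]
    simp only [sub_self, abs_zero]
    have : 0 < t - s := by linarith
    positivity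
  set P := pnorm (x, t) with hPdef
  have hP : 0 < P := pnorm_pos_of (p := (x, t)) ht
  have htP : t ≤ P ^ 2 := by
    have := abs_le_pnorm_sq (x, t); simpa [abs_of_pos ht] using this
  have hd0 : 0 < t - s := by linarith
  have hWt := h (x, t) ht
  simp only at hWt
  rw [← hPdef] at hWt
  have hnn : (0:ℝ) ≤ n * 2 ^ (n+2) := by positivity
  -- W(x,t) ≤ C t P^{-n-2}
  have hWt' : heatW (x, t) ≤ C * t * P⁻¹ ^ (n+2) := by
    refine hWt.trans ?_
    rw [inv_pow, ← div_eq_mul_inv, div_le_div_iff₀ (by positivity) (by positivity)]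
    calc C * t^2 * P ^ (n+2) = C * t * P^(n+2) * t := by ring
      _ ≤ C * t * P^(n+2) * P^2 := by gcongr
      _ = _ := by ring
  rcases le_or_gt s 0 with hs | hs
  · rw [heatW_nonpos (p := (x, s)) hs, sub_zero, abs_of_nonneg (heatW_nonneg _)]
    refine hWt'.trans ?_
    gcongr
    · nlinarith
    · linarith
  -- main case
  have hPs : P / 2 ≤ pnorm (x, s) := by
    have h1 : P ^ 2 / 2 ≤ pnorm (x, s) ^ 2 := by
      have h2 := norm_le_pnorm (x, s)
      have h3 := abs_le_pnorm_sq (x, s)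
      simp only [abs_of_pos hs] at h2 h3
      rcases max_cases ‖x‖ (√|t|) with ⟨h4, _⟩ | ⟨h4, _⟩
      · have : P = ‖x‖ := h4
        rw [this]; nlinarith [norm_nonneg x]
      · have : P ^ 2 = t := by
          have : P = √|t| := h4
          rw [this, abs_of_pos ht, Real.sq_sqrt ht.le]
        linarith
    by_contra hcon
    push Not at hcon
    nlinarith [pnorm_nonneg (x, s)]
  have hPs0 : 0 < pnorm (x, s) := by linarith
  rw [abs_le]
  constructor
  · have h1 := heatW_time_mono x hs hst
    have h2 := one_sub_rpow_le (n := n) hs hst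
    have h3 : heatW (x, s) ≤ C * t * (2 ^ (n+2) * P⁻¹ ^ (n+2)) := by
      have hss := h (x, s) hs
      have h4 : s ≤ pnorm (x, s) ^ 2 := by
        have := abs_le_pnorm_sq (x, s); simpa [abs_of_pos hs] using this
      simp only at hss
      calc heatW (x, s) ≤ C * s ^ 2 / pnorm (x, s) ^ (n+4) := hss
        _ ≤ C * s * (pnorm (x, s))⁻¹ ^ (n+2) := by
            rw [inv_pow, ← div_eq_mul_inv, div_le_div_iff₀ (by positivity) (by positivity)]
            calc C * s^2 * pnorm (x, s) ^ (n+2) = C * s * pnorm (x, s)^(n+2) * s := by ring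
              _ ≤ C * s * pnorm (x, s)^(n+2) * pnorm (x, s)^2 := by gcongr
              _ = _ := by ring
        _ ≤ C * t * ((P/2)⁻¹) ^ (n+2) := by gcongr
        _ = _ := by rw [inv_div, div_eq_mul_inv, mul_pow]
    have h5 : heatW (x, s) - heatW (x, t) ≤ n * ((t - s)/t) * (C * t * (2 ^ (n+2) * P⁻¹ ^ (n+2))) := by
      have : heatW (x, s) - heatW (x, t) ≤ (1 - (s / t) ^ ((n : ℝ) / 2)) * heatW (x, s) := by linarith
      refine this.trans ?_
      gcongr
      exact heatW_nonneg _
    have h6 : n * ((t - s)/t) * (C * t * (2 ^ (n+2) * P⁻¹ ^ (n+2))) = C * (n * 2^(n+2)) * (t - s) * P⁻¹^(n+2) := by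
      field_simp
    have h7 : 0 ≤ C * 2 * (t - s) * P⁻¹^(n+2) := by positivity
    have h8 : C * (2 + n * 2 ^ (n + 2)) * (t - s) * P⁻¹^(n+2) = C * 2 * (t - s) * P⁻¹^(n+2) +
      C * (n * 2^(n+2)) * (t - s) * P⁻¹^(n+2) := by ring
    linarith
  · have hgoal : heatW (x, t) - heatW (x, s) ≤ C * 2 * (t - s) * P⁻¹ ^ (n+2) := by
      rcases lt_or_ge s (t/2) with hs2 | hs2
      · have := heatW_nonneg (x, s)
        have h1 : C * t * P⁻¹ ^ (n+2) ≤ C * 2 * (t - s) * P⁻¹ ^ (n+2) := by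
          gcongr ?_ * _
          nlinarith
        linarith
      · have h1 : heatW (x, t) * (1 - ‖x‖^2 * (t - s)/(4 * s * t)) ≤ heatW (x, s) := by
          have h2 : heatW (x, t) * Real.exp (-(‖x‖^2 * (t - s)/(4 * s * t))) ≤ heatW (x, s) := by
            rw [heatW_eq (p := (x, s)) hs, heatW_eq (p := (x, t)) ht]
            simp only
            rw [mul_assoc, ← Real.exp_add]
            have e : -‖x‖ ^ 2 / (4 * t) + -(‖x‖ ^ 2 * (t - s) / (4 * s * t)) = -‖x‖ ^ 2 / (4 * s) := by
              field_simp; ring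
            rw [e]
            gcongr ?_ * _
            apply Real.rpow_le_rpow_of_nonpos (by positivity) (by gcongr)
            apply div_nonpos_of_nonpos_of_nonneg <;> simp
          have h3 := Real.add_one_le_exp (-(‖x‖^2 * (t - s)/(4 * s * t)))
          refine le_trans ?_ h2
          gcongr
          · exact heatW_nonneg _
          · linarith
        have h4 : heatW (x, t) - heatW (x, s) ≤ heatW (x, t) * (‖x‖^2 * (t - s)/(4 * s * t)) := by linarith
        have hx : ‖x‖ ≤ P := norm_le_pnorm (x, t)
        calc _ ≤ heatW (x, t) * (‖x‖^2 * (t - s)/(4 * s * t)) := h4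
          _ ≤ (C * t ^ 2 / P ^ (n+4)) * (P^2 * (t - s)/(4 * (t/2) * t)) := by
              gcongr
          _ = C * (1/2) * (t - s) * P⁻¹ ^ (n+2) := by
              rw [inv_pow, pow_add P n 4, pow_add P n 2]; field_simp; norm_num
          _ ≤ _ := by gcongr; norm_num
    refine hgoal.trans ?_
    gcongr
    linarith

/-- Time regularity of the heat kernel. -/
lemma heatW_diff (n : ℕ) : ∃ C : ℝ, 0 < C ∧ ∀ (x : Spc n) (s t : ℝ),
    4 * |t - s| ≤ pnorm (x, t) ^ 2 →
    |heatW (x, t) - heatW (x, s)| ≤ C * |t - s| * (pnorm (x, t))⁻¹ ^ (n + 2) := by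
  obtain ⟨C, hC, h⟩ := heatW_diff_aux n
  refine ⟨C * 2 ^ (n+2), by positivity, ?_⟩
  intro x s t hd
  have hP0 := pnorm_nonneg (x, t)
  rcases lt_trichotomy s t with hst | hst | hst
  · rw [abs_of_pos (by linarith : 0 < t - s)] at hd ⊢
    refine (h x s t hst (by linarith)).trans ?_
    have : (1:ℝ) ≤ 2 ^ (n+2) := one_le_pow₀ (by norm_num)
    have : 0 < t - s := by linarith
    gcongr
    nlinarith
  · subst hst; simp
  · rw [abs_of_neg (by linarith : t - s < 0)] at hd ⊢
    rw [abs_sub_comm]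
    have h1 : pnorm (x, t) ^ 2 * (1/4) ≤ pnorm (x, s) ^ 2 ∧ 2 * (s - t) ≤ pnorm (x, s) ^ 2 := by
      have h2 := norm_le_pnorm (x, s)
      have h3 := abs_le_pnorm_sq (x, s)
      simp only at h2 h3
      rcases max_cases ‖x‖ (√|t|) with ⟨h4, _⟩ | ⟨h4, _⟩
      · have : pnorm (x, t) = ‖x‖ := h4
        rw [this] at hd ⊢; constructor <;> nlinarith [norm_nonneg x]
      · have e : pnorm (x, t) ^ 2 = |t| := by
          have : pnorm (x, t) = √|t| := h4
          rw [this, Real.sq_sqrt (abs_nonneg t)]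
        rw [e] at hd ⊢
        have : |t| ≤ |s| + (s - t) := by
          have := abs_sub_abs_le_abs_sub t s
          rw [abs_of_neg (by linarith : t - s < 0)] at this
          linarith
        constructor <;> nlinarith [abs_nonneg t]
    refine (h x t s hst h1.2).trans ?_
    have hpos : 0 < pnorm (x, t) := by
      by_contra hcon
      have : pnorm (x, t) = 0 := le_antisymm (not_lt.1 hcon) hP0
      rw [this] at hd; norm_num at hd; linarith
    have h5 : pnorm (x, t) / 2 ≤ pnorm (x, s) := by
      by_contra hcon
      push Not at hcon
      nlinarith [pnorm_nonneg (x, s)]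
    have : 0 < s - t := by linarith
    have hs0 := pnorm_nonneg (x, s)
    calc C * (s - t) * (pnorm (x, s))⁻¹ ^ (n+2) ≤ C * (s - t) * (pnorm (x, t) / 2)⁻¹ ^ (n+2) := by
          gcongr
      _ = _ := by rw [inv_div, div_eq_mul_inv, mul_pow]; ring


lemma tsum_ofReal_geom (c : ℝ) (hc : 0 ≤ c) :
    ∑' k : ℕ, ENNReal.ofReal (c * (1/2)^k) = ENNReal.ofReal (2 * c) := by
  rw [← ENNReal.ofReal_tsum_of_nonneg (fun k => by positivity)
    ((summable_geometric_two).mul_left c), tsum_mul_left, tsum_geometric_two, mul_comm]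

lemma near_growth {n : ℕ} (ν : Measure (Pt n)) (c : Pt n) (A : ENNReal) (a : ℕ)
    (h : ∀ r : ℝ, 0 < r → ν (pball c r) ≤ A * ENNReal.ofReal (r ^ (a + 1))) (r : ℝ) (hr : 0 < r) :
    ∫⁻ y in pball c r, ENNReal.ofReal ((pnorm (c - y))⁻¹ ^ a) ∂ν ≤
      A * ENNReal.ofReal (4 ^ (a + 1) * r) := by
  have hpt : ∀ y ∈ pball c r, ENNReal.ofReal ((pnorm (c - y))⁻¹ ^ a) ≤
      ∑' k : ℕ, (pball c (2 * r * (1/2)^k)).indicator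
        (fun _ => ENNReal.ofReal ((2 ^ (k+1) / r) ^ a)) y := by
    intro y hy
    have hy' : pnorm (c - y) < r := by rw [pnorm_sub_comm]; exact hy
    rcases (pnorm_nonneg (c - y)).eq_or_lt with h0 | h0
    · refine le_trans ?_ (ENNReal.le_tsum 0)
      rw [indicator_of_mem]
      · rw [← h0, inv_zero]; gcongr; positivity
      · show pnorm (y - c) < _
        rw [pnorm_sub_comm, ← h0]; positivity
    · obtain ⟨k, hk1, hk2⟩ := exists_nat_pow_near (x := r / pnorm (c - y)) (y := 2)
        ((one_le_div h0).2 hy'.le) (by norm_num)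
      refine le_trans ?_ (ENNReal.le_tsum k)
      rw [indicator_of_mem]
      · gcongr
        rw [inv_eq_one_div, div_le_div_iff₀ h0 hr]
        rw [div_lt_iff₀ h0] at hk2
        linarith
      · show pnorm (y - c) < _
        rw [pnorm_sub_comm]
        rw [le_div_iff₀ h0] at hk1
        rw [one_div, inv_pow, ← div_eq_mul_inv, lt_div_iff₀ (by positivity)]
        linarith
  calc _ ≤ ∫⁻ y in pball c r, ∑' k : ℕ, (pball c (2 * r * (1/2)^k)).indicator
        (fun _ => ENNReal.ofReal ((2 ^ (k+1) / r) ^ a)) y ∂ν :=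
        setLIntegral_mono' (measurableSet_pball _ _) hpt
    _ ≤ ∫⁻ y, ∑' k : ℕ, (pball c (2 * r * (1/2)^k)).indicator
        (fun _ => ENNReal.ofReal ((2 ^ (k+1) / r) ^ a)) y ∂ν := setLIntegral_le_lintegral _ _
    _ = ∑' k : ℕ, ENNReal.ofReal ((2 ^ (k+1) / r) ^ a) * ν (pball c (2 * r * (1/2)^k)) := by
        rw [lintegral_tsum (fun k =>
          (measurable_const.indicator (measurableSet_pball _ _)).aemeasurable)]
        congr 1; ext k
        rw [lintegral_indicator_const (measurableSet_pball _ _)]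
    _ ≤ ∑' k : ℕ, A * ENNReal.ofReal ((2 * 4 ^ a * r) * (1/2)^k) := by
        refine ENNReal.tsum_le_tsum fun k => ?_
        refine (mul_le_mul_right (h _ (by positivity)) _).trans (le_of_eq ?_)
        rw [← mul_assoc, mul_comm _ A, mul_assoc, ← ENNReal.ofReal_mul (by positivity)]
        congr 2
        have h4 : (4:ℝ)^a = 2^a * 2^a := by rw [← mul_pow]; norm_num
        rw [h4, pow_succ (2 * r * (1/2)^k) a, div_pow, pow_succ 2 k, mul_pow, mul_pow, mul_pow,
          one_div, inv_pow, inv_pow]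
        field_simp
    _ = _ := by
        rw [ENNReal.tsum_mul_left, tsum_ofReal_geom _ (by positivity)]
        congr 2; ring

lemma far_growth {n : ℕ} (ν : Measure (Pt n)) (c : Pt n) (A : ENNReal) (b : ℕ)
    (h : ∀ r : ℝ, 0 < r → ν (pball c r) ≤ A * ENNReal.ofReal (r ^ b)) (r : ℝ) (hr : 0 < r) :
    ∫⁻ y in (pball c r)ᶜ, ENNReal.ofReal ((pnorm (c - y))⁻¹ ^ (b + 1)) ∂ν ≤
      A * ENNReal.ofReal (2 ^ (b + 1) * r⁻¹) := by
  have hpt : ∀ y ∈ (pball c r)ᶜ, ENNReal.ofReal ((pnorm (c - y))⁻¹ ^ (b + 1)) ≤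
      ∑' k : ℕ, (pball c (r * 2 ^ (k+1))).indicator
        (fun _ => ENNReal.ofReal ((r * 2 ^ k)⁻¹ ^ (b+1))) y := by
    intro y hy
    have hy' : r ≤ pnorm (c - y) := by
      rw [pnorm_sub_comm]; exact not_lt.1 hy
    have h0 : 0 < pnorm (c - y) := hr.trans_le hy'
    obtain ⟨k, hk1, hk2⟩ := exists_nat_pow_near (x := pnorm (c - y) / r) (y := 2)
        ((one_le_div hr).2 hy') (by norm_num)
    rw [le_div_iff₀ hr] at hk1
    rw [div_lt_iff₀ hr] at hk2
    refine le_trans ?_ (ENNReal.le_tsum k)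
    rw [indicator_of_mem]
    · gcongr
      linarith
    · show pnorm (y - c) < _
      rw [pnorm_sub_comm]
      linarith
  calc _ ≤ ∫⁻ y in (pball c r)ᶜ, ∑' k : ℕ, (pball c (r * 2 ^ (k+1))).indicator
        (fun _ => ENNReal.ofReal ((r * 2 ^ k)⁻¹ ^ (b+1))) y ∂ν :=
        setLIntegral_mono' (measurableSet_pball _ _).compl hpt
    _ ≤ ∫⁻ y, ∑' k : ℕ, (pball c (r * 2 ^ (k+1))).indicator
        (fun _ => ENNReal.ofReal ((r * 2 ^ k)⁻¹ ^ (b+1))) y ∂ν := setLIntegral_le_lintegral _ _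
    _ = ∑' k : ℕ, ENNReal.ofReal ((r * 2 ^ k)⁻¹ ^ (b+1)) * ν (pball c (r * 2 ^ (k+1))) := by
        rw [lintegral_tsum (fun k =>
          (measurable_const.indicator (measurableSet_pball _ _)).aemeasurable)]
        congr 1; ext k
        rw [lintegral_indicator_const (measurableSet_pball _ _)]
    _ ≤ ∑' k : ℕ, A * ENNReal.ofReal ((2 ^ b * r⁻¹) * (1/2)^k) := by
        refine ENNReal.tsum_le_tsum fun k => ?_
        refine (mul_le_mul_right (h _ (by positivity)) _).trans (le_of_eq ?_)
        rw [← mul_assoc, mul_comm _ A, mul_assoc, ← ENNReal.ofReal_mul (by positivity)]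
        congr 2
        rw [pow_succ 2 k, ← mul_assoc r, mul_pow _ 2 b, pow_succ _ b, inv_pow, one_div, inv_pow]
        field_simp
    _ = _ := by
        rw [ENNReal.tsum_mul_left, tsum_ofReal_geom _ (by positivity)]
        congr 2; ring

lemma near_int (n : ℕ) : ∃ C : ℝ, 0 < C ∧ ∀ μ : Measure (Pt n), PGrowth μ → ∀ c r, 0 < r →
    ∫⁻ y in pball c r, ‖heatW (c - y)‖ₑ ∂μ ≤ ENNReal.ofReal (C * r) := by
  obtain ⟨C, hC, h⟩ := heatW_le_pow n
  refine ⟨C * 4 ^ (n+1), by positivity, fun μ hμ c r hr => ?_⟩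
  calc _ ≤ ∫⁻ y in pball c r, ENNReal.ofReal C * ENNReal.ofReal ((pnorm (c - y))⁻¹ ^ n) ∂μ := by
        refine lintegral_mono fun y => ?_
        rw [Real.enorm_of_nonneg (heatW_nonneg _), ← ENNReal.ofReal_mul hC.le]
        exact ENNReal.ofReal_le_ofReal (h _)
    _ = ENNReal.ofReal C * ∫⁻ y in pball c r, ENNReal.ofReal ((pnorm (c - y))⁻¹ ^ n) ∂μ := by
        rw [lintegral_const_mul _ (by fun_prop)]
    _ ≤ ENNReal.ofReal C * (1 * ENNReal.ofReal (4 ^ (n+1) * r)) := by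
        gcongr
        exact near_growth μ c 1 n (fun r hr => by simpa using hμ c r hr) r hr
    _ = _ := by
        rw [one_mul, ← ENNReal.ofReal_mul hC.le]; congr 1; ring

lemma far_diff (n : ℕ) : ∃ C : ℝ, 0 < C ∧ ∀ μ : Measure (Pt n), PGrowth μ →
    ∀ (x : Spc n) (t s r : ℝ), 0 < r → 4 * |t - s| ≤ r ^ 2 →
    ∫⁻ y in (pball (x, t) r)ᶜ, ‖heatW ((x, t) - y) - heatW ((x, s) - y)‖ₑ ∂μ ≤
      ENNReal.ofReal (C * |t - s| * r⁻¹) := by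
  obtain ⟨C, hC, h⟩ := heatW_diff n
  refine ⟨C * 2 ^ (n+2), by positivity, fun μ hμ x t s r hr hd => ?_⟩
  calc _ ≤ ∫⁻ y in (pball (x, t) r)ᶜ, ENNReal.ofReal (C * |t - s|) *
          ENNReal.ofReal ((pnorm ((x, t) - y))⁻¹ ^ (n + 2)) ∂μ := by
        refine setLIntegral_mono' (measurableSet_pball _ _).compl fun y hy => ?_
        rw [← ENNReal.ofReal_mul (by positivity), Real.enorm_eq_ofReal_abs]
        apply ENNReal.ofReal_le_ofReal
        have hy' : r ≤ pnorm ((x, t) - y) := by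
          rw [pnorm_sub_comm]; exact not_lt.1 hy
        obtain ⟨y1, y2⟩ := y
        simp only [Prod.mk_sub_mk] at hy' ⊢
        have := h (x - y1) (s - y2) (t - y2) (by
          rw [sub_sub_sub_cancel_right]
          refine hd.trans ?_
          gcongr)
        rwa [sub_sub_sub_cancel_right] at this
    _ = ENNReal.ofReal (C * |t - s|) * ∫⁻ y in (pball (x, t) r)ᶜ,
          ENNReal.ofReal ((pnorm ((x, t) - y))⁻¹ ^ (n + 2)) ∂μ := by
        rw [lintegral_const_mul _ (by fun_prop)]
    _ ≤ ENNReal.ofReal (C * |t - s|) * (1 * ENNReal.ofReal (2 ^ (n+2) * r⁻¹)) := by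
        gcongr
        exact far_growth μ (x, t) 1 (n+1) (fun r hr => by simpa using hμ (x, t) r hr) r hr
    _ = _ := by
        rw [one_mul, ← ENNReal.ofReal_mul (by positivity)]; congr 1; ring

/-- Growth gives half-Lipschitz regularity in time. -/
lemma time_diff (n : ℕ) : ∃ C : ℝ, 0 < C ∧ ∀ μ : Measure (Pt n), PGrowth μ →
    ∀ (x : Spc n) (t s : ℝ),
    ∫⁻ y, ‖heatW ((x, t) - y) - heatW ((x, s) - y)‖ₑ ∂μ ≤ ENNReal.ofReal (C * √|t - s|) := by
  obtain ⟨C1, hC1, h1⟩ := near_int n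
  obtain ⟨C2, hC2, h2⟩ := far_diff n
  refine ⟨6 * C1 + C2, by positivity, fun μ hμ x t s => ?_⟩
  rcases eq_or_ne t s with rfl | hts
  · simp
  set d := √|t - s| with hd
  have hd0 : 0 < d := Real.sqrt_pos.2 (abs_pos.2 (sub_ne_zero.2 hts))
  have hdd : d ^ 2 = |t - s| := Real.sq_sqrt (abs_nonneg _)
  have hsub : pball (x, t) (2 * d) ⊆ pball (x, s) (4 * d) := by
    intro y hy
    have h3 := pnorm_sub_le y (x, t) (x, s)
    have h4 : pnorm (((x, t) : Pt n) - (x, s)) ≤ d := by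
      apply pnorm_le hd0.le
      · simp [hd0.le]
      · simp [hdd]
    have h5 : pnorm (y - (x, t)) < 2 * d := hy
    show pnorm (y - (x, s)) < 4 * d
    linarith
  have hnear : ∫⁻ y in pball (x, t) (2 * d), ‖heatW ((x, t) - y) - heatW ((x, s) - y)‖ₑ ∂μ ≤
      ENNReal.ofReal (C1 * (2 * d)) + ENNReal.ofReal (C1 * (4 * d)) := by
    calc _ ≤ ∫⁻ y in pball (x, t) (2 * d), (‖heatW ((x, t) - y)‖ₑ + ‖heatW ((x, s) - y)‖ₑ) ∂μ :=
          lintegral_mono fun y => enorm_sub_le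
      _ = ∫⁻ y in pball (x, t) (2 * d), ‖heatW ((x, t) - y)‖ₑ ∂μ +
          ∫⁻ y in pball (x, t) (2 * d), ‖heatW ((x, s) - y)‖ₑ ∂μ :=
          lintegral_add_left (by fun_prop) _
      _ ≤ _ := by
          gcongr
          · exact h1 μ hμ _ _ (by positivity)
          · exact (lintegral_mono_set hsub).trans (h1 μ hμ _ _ (by positivity))
  have hfar := h2 μ hμ x t s (2 * d) (by positivity) (by rw [← hdd]; nlinarith)
  rw [← lintegral_add_compl _ (measurableSet_pball (x, t) (2 * d))]
  refine (add_le_add hnear hfar).trans ?_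
  rw [← ENNReal.ofReal_add (by positivity) (by positivity),
    ← ENNReal.ofReal_add (by positivity) (by positivity)]
  apply ENNReal.ofReal_le_ofReal
  rw [← hdd]
  have : C2 * d ^ 2 * (2 * d)⁻¹ = C2 * d / 2 := by field_simp
  rw [this]
  nlinarith [mul_pos hC2 hd0]

/-- The (extended) potential. -/
def eW {n : ℕ} (μ : Measure (Pt n)) (p : Pt n) : ENNReal := ∫⁻ y, ‖heatW (p - y)‖ₑ ∂μ

lemma eW_time (n : ℕ) : ∃ C : ℝ, 0 < C ∧ ∀ μ : Measure (Pt n), PGrowth μ →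
    ∀ (x : Spc n) (t s : ℝ), eW μ (x, t) ≤ eW μ (x, s) + ENNReal.ofReal (C * √|t - s|) := by
  obtain ⟨C, hC, h⟩ := time_diff n
  refine ⟨C, hC, fun μ hμ x t s => ?_⟩
  calc eW μ (x, t) ≤ ∫⁻ y, (‖heatW ((x, s) - y)‖ₑ + ‖heatW ((x, t) - y) - heatW ((x, s) - y)‖ₑ) ∂μ := by
        refine lintegral_mono fun y => ?_
        calc ‖heatW ((x, t) - y)‖ₑ = ‖heatW ((x, s) - y) + (heatW ((x, t) - y) - heatW ((x, s) - y))‖ₑ := by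
              congr 1; ring
          _ ≤ _ := enorm_add_le _ _
    _ = eW μ (x, s) + ∫⁻ y, ‖heatW ((x, t) - y) - heatW ((x, s) - y)‖ₑ ∂μ :=
        lintegral_add_left (by fun_prop) _
    _ ≤ _ := by gcongr; exact h μ hμ x t s

lemma harnack {n : ℕ} (x x' : Spc n) {τ δ K : ℝ} (hδ : 0 < δ) (hK : 0 < K) (hτ : K * δ ≤ τ) :
    heatW (x', τ) ≤ (1 + 1 / K) ^ ((n:ℝ)/2) * Real.exp (‖x - x'‖ ^ 2 / (4 * δ)) *
      heatW (x, τ + δ) := by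
  have hτ0 : 0 < τ := lt_of_lt_of_le (by positivity) hτ
  have hτ1 : 0 < τ + δ := by positivity
  rw [heatW_eq (p := (x', τ)) hτ0, heatW_eq (p := (x, τ + δ)) hτ1]
  simp only
  have e1 : (4 * π * τ) ^ (-(n:ℝ)/2) ≤ (1 + 1/K) ^ ((n:ℝ)/2) * (4 * π * (τ + δ)) ^ (-(n:ℝ)/2) := by
    have h1 : (1 + 1/K) ^ ((n:ℝ)/2) = ((1 + 1/K)⁻¹) ^ (-(n:ℝ)/2) := by
      rw [neg_div, Real.rpow_neg (by positivity), Real.inv_rpow (by positivity), inv_inv]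
    rw [h1, ← Real.mul_rpow (by positivity) (by positivity)]
    apply Real.rpow_le_rpow_of_nonpos (by positivity)
    · rw [inv_mul_le_iff₀ (by positivity)]
      have : δ ≤ 1 / K * τ := by
        rw [one_div, le_inv_mul_iff₀ hK]; exact hτ
      nlinarith [Real.pi_pos]
    · apply div_nonpos_of_nonpos_of_nonneg <;> simp
  have e2 : Real.exp (-‖x'‖ ^ 2 / (4 * τ)) ≤
      Real.exp (‖x - x'‖ ^ 2 / (4 * δ)) * Real.exp (-‖x‖ ^ 2 / (4 * (τ + δ))) := by
    rw [← Real.exp_add, Real.exp_le_exp]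
    have hx : ‖x‖ ≤ ‖x'‖ + ‖x - x'‖ := by
      have := norm_add_le x' (x - x'); rwa [add_sub_cancel] at this
    have hx2 : ‖x‖ ^ 2 ≤ (‖x'‖ + ‖x - x'‖) ^ 2 := by gcongr
    have key : ‖x‖ ^ 2 / (τ + δ) ≤ ‖x'‖ ^ 2 / τ + ‖x - x'‖ ^ 2 / δ := by
      rw [div_add_div _ _ hτ0.ne' hδ.ne', div_le_div_iff₀ hτ1 (by positivity)]
      have : (‖x'‖ + ‖x - x'‖) ^ 2 * (τ * δ) ≤ (‖x'‖ ^ 2 * δ + τ * ‖x - x'‖ ^ 2) * (τ + δ) := by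
        nlinarith [sq_nonneg (‖x'‖ * δ - ‖x - x'‖ * τ)]
      refine le_trans ?_ this
      gcongr
    have a1 : -‖x'‖ ^ 2 / (4 * τ) = - (‖x'‖ ^ 2 / τ) / 4 := by field_simp
    have a2 : -‖x‖ ^ 2 / (4 * (τ + δ)) = - (‖x‖ ^ 2 / (τ + δ)) / 4 := by field_simp
    have a3 : ‖x - x'‖ ^ 2 / (4 * δ) = (‖x - x'‖ ^ 2 / δ) / 4 := by field_simp
    rw [a1, a2, a3]; linarith
  calc _ ≤ ((1 + 1/K) ^ ((n:ℝ)/2) * (4 * π * (τ + δ)) ^ (-(n:ℝ)/2)) *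
        (Real.exp (‖x - x'‖ ^ 2 / (4 * δ)) * Real.exp (-‖x‖ ^ 2 / (4 * (τ + δ)))) := by gcongr
    _ = _ := by ring

lemma eW_space (n : ℕ) : ∃ C : ℝ, 0 < C ∧ ∀ μ : Measure (Pt n), PGrowth μ →
    ∀ (x x' : Spc n) (t δ K : ℝ), 0 < δ → 0 < K →
    eW μ (x', t) ≤ ENNReal.ofReal (C * √(K * δ)) +
      ENNReal.ofReal ((1 + 1 / K) ^ ((n:ℝ)/2) * Real.exp (‖x - x'‖ ^ 2 / (4 * δ))) *
        (eW μ (x, t) + ENNReal.ofReal (C * √δ)) := by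
  obtain ⟨C1, hC1, h1⟩ := time_diff n
  obtain ⟨C2, hC2, h2⟩ := eW_time n
  refine ⟨C1 + C2, by positivity, fun μ hμ x x' t δ K hδ hK => ?_⟩
  set A := (1 + 1 / K) ^ ((n:ℝ)/2) * Real.exp (‖x - x'‖ ^ 2 / (4 * δ)) with hA
  have hA0 : 0 ≤ A := by positivity
  calc eW μ (x', t) ≤ ∫⁻ y, (‖heatW ((x', t) - y) - heatW ((x', t - K * δ) - y)‖ₑ +
        ENNReal.ofReal A * ‖heatW ((x, t + δ) - y)‖ₑ) ∂μ := by
        refine lintegral_mono fun y => ?_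
        obtain ⟨y1, y2⟩ := y
        simp only [Prod.mk_sub_mk]
        rcases le_or_gt (t - y2) (K * δ) with hc | hc
        · rw [heatW_nonpos (p := (x' - y1, t - K * δ - y2)) (by simp only; linarith), sub_zero]
          exact le_self_add
        · refine le_trans ?_ le_add_self
          rw [Real.enorm_of_nonneg (heatW_nonneg _), Real.enorm_of_nonneg (heatW_nonneg _),
            ← ENNReal.ofReal_mul hA0]
          apply ENNReal.ofReal_le_ofReal
          have := harnack (x - y1) (x' - y1) hδ hK hc.le
          rw [sub_sub_sub_cancel_right] at this
          rw [show t + δ - y2 = t - y2 + δ by ring]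
          exact this
    _ = ∫⁻ y, ‖heatW ((x', t) - y) - heatW ((x', t - K * δ) - y)‖ₑ ∂μ +
        ENNReal.ofReal A * eW μ (x, t + δ) := by
        rw [lintegral_add_left (by fun_prop), lintegral_const_mul _ (by fun_prop), eW]
    _ ≤ _ := by
        gcongr
        · refine (h1 μ hμ _ _ _).trans (ENNReal.ofReal_le_ofReal ?_)
          rw [sub_sub_cancel, abs_of_pos (by positivity)]
          gcongr; linarith
        · refine (h2 μ hμ x (t + δ) t).trans ?_
          rw [add_sub_cancel_left, abs_of_pos hδ]
          gcongr; linarith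

lemma eW_finite_iff {n : ℕ} {μ : Measure (Pt n)} (hμ : PGrowth μ) (p q : Pt n)
    (h : eW μ p < ⊤) : eW μ q < ⊤ := by
  obtain ⟨C1, hC1, h1⟩ := eW_time n
  obtain ⟨C2, hC2, h2⟩ := eW_space n
  obtain ⟨x, t⟩ := p
  obtain ⟨x', t'⟩ := q
  have h3 : eW μ (x, t') < ⊤ :=
    (h1 μ hμ x t' t).trans_lt (ENNReal.add_lt_top.2 ⟨h, ENNReal.ofReal_lt_top⟩)
  refine (h2 μ hμ x x' t' 1 1 one_pos one_pos).trans_lt ?_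
  refine ENNReal.add_lt_top.2 ⟨ENNReal.ofReal_lt_top, ENNReal.mul_lt_top ENNReal.ofReal_lt_top ?_⟩
  exact ENNReal.add_lt_top.2 ⟨h3, ENNReal.ofReal_lt_top⟩

lemma integrable_of_eW {n : ℕ} {μ : Measure (Pt n)} {p : Pt n} (h : eW μ p < ⊤) :
    Integrable (fun y => heatW (p - y)) μ :=
  ⟨Measurable.aestronglyMeasurable (by fun_prop), h⟩

lemma mconvW_eq_eW {n : ℕ} {μ : Measure (Pt n)} {p : Pt n} :
    mconvW μ p = (eW μ p).toReal := by
  unfold mconvW eW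
  rw [integral_eq_lintegral_of_nonneg_ae (.of_forall fun y => heatW_nonneg _)
    (Measurable.aestronglyMeasurable (by fun_prop))]
  congr 1
  refine lintegral_congr fun y => ?_
  rw [Real.enorm_of_nonneg (heatW_nonneg _)]

lemma mconvW_nonneg {n : ℕ} (μ : Measure (Pt n)) (p : Pt n) : 0 ≤ mconvW μ p := by
  rw [mconvW_eq_eW]; exact ENNReal.toReal_nonneg

lemma mconvW_time (n : ℕ) : ∃ C : ℝ, 0 < C ∧ ∀ μ : Measure (Pt n), PGrowth μ →
    (∀ p, eW μ p < ⊤) →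
    ∀ (x : Spc n) (t s : ℝ), |mconvW μ (x, t) - mconvW μ (x, s)| ≤ C * √|t - s| := by
  obtain ⟨C1, hC1, h1⟩ := eW_time n
  refine ⟨C1, hC1, fun μ hμ hfin => ?_⟩
  have key : ∀ (x : Spc n) (t s : ℝ), mconvW μ (x, t) ≤ mconvW μ (x, s) + C1 * √|t - s| := by
    intro x t s
    have := ENNReal.toReal_mono (ENNReal.add_lt_top.2 ⟨hfin _, ENNReal.ofReal_lt_top⟩).ne (h1 μ hμ x t s)
    rw [ENNReal.toReal_add (hfin _).ne ENNReal.ofReal_ne_top, ENNReal.toReal_ofReal (by positivity),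
      ← mconvW_eq_eW, ← mconvW_eq_eW] at this
    exact this
  intro x t s
  have h2 := key x t s
  have h3 := key x s t
  rw [abs_sub_comm s t] at h3
  rw [abs_le]; constructor <;> linarith

lemma mconvW_continuous_space {n : ℕ} {μ : Measure (Pt n)} (hμ : PGrowth μ)
    (hfin : ∀ p, eW μ p < ⊤) (t : ℝ) : Continuous fun x => mconvW μ (x, t) := by
  obtain ⟨C, hC, h⟩ := eW_space n
  set A : ℝ → ℝ := fun e => (1 + √e) ^ ((n:ℝ)/2) * Real.exp (e / 4) with hA
  set B : ℝ → ℝ := fun e => C * √(√e) + A e * (C * √e) with hB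
  have hAc : Continuous A := by
    apply Continuous.mul _ (by fun_prop)
    apply Continuous.rpow_const (by fun_prop)
    intro e; right; positivity
  have hBc : Continuous B := by fun_prop
  have hA0 : A 0 = 1 := by simp [hA]
  have hB0 : B 0 = 0 := by simp [hB]
  have hApos : ∀ e, 0 < A e := fun e => by simp only [hA]; positivity
  have key : ∀ x x' : Spc n, mconvW μ (x', t) ≤ A ‖x - x'‖ * mconvW μ (x, t) + B ‖x - x'‖ := by
    intro x x'
    rcases eq_or_ne x x' with rfl | hne
    · simp [hA0, hB0]
    set e := ‖x - x'‖ with he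
    have he0 : 0 < e := norm_pos_iff.2 (sub_ne_zero.2 hne)
    have h1 := h μ hμ x x' t e (1 / √e) he0 (by positivity)
    have h2 := ENNReal.toReal_mono (by
      refine (ENNReal.add_lt_top.2 ⟨ENNReal.ofReal_lt_top, ENNReal.mul_lt_top ENNReal.ofReal_lt_top ?_⟩).ne
      exact ENNReal.add_lt_top.2 ⟨hfin _, ENNReal.ofReal_lt_top⟩) h1
    rw [ENNReal.toReal_add ENNReal.ofReal_ne_top (ENNReal.mul_lt_top ENNReal.ofReal_lt_top
      (ENNReal.add_lt_top.2 ⟨hfin _, ENNReal.ofReal_lt_top⟩)).ne, ENNReal.toReal_mul,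
      ENNReal.toReal_add (hfin _).ne ENNReal.ofReal_ne_top, ENNReal.toReal_ofReal (by positivity),
      ENNReal.toReal_ofReal (by positivity), ENNReal.toReal_ofReal (by positivity),
      ← mconvW_eq_eW, ← mconvW_eq_eW] at h2
    have e1 : 1 / √e * e = √e := by
      rw [one_div, inv_mul_eq_div, Real.div_sqrt]
    have e2 : 1 / (1 / √e) = √e := one_div_one_div _
    have e3 : ‖x - x'‖ ^ 2 / (4 * e) = e / 4 := by rw [← he]; field_simp
    rw [e1, e2, e3] at h2
    simp only [hB, hA]
    linarith
  rw [continuous_iff_continuousAt]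
  intro x
  have hlow : ∀ x', (mconvW μ (x, t) - B ‖x - x'‖) / A ‖x - x'‖ ≤ mconvW μ (x', t) := by
    intro x'
    have := key x' x
    rw [norm_sub_rev] at this
    rw [div_le_iff₀ (hApos _)]; linarith
  refine tendsto_of_tendsto_of_tendsto_of_le_of_le (g := fun x' => (mconvW μ (x, t) - B ‖x - x'‖) / A ‖x - x'‖)
    (h := fun x' => A ‖x - x'‖ * mconvW μ (x, t) + B ‖x - x'‖) ?_ ?_ hlow (key x)
  · have : Continuous fun x' : Spc n => (mconvW μ (x, t) - B ‖x - x'‖) / A ‖x - x'‖ :=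
      Continuous.div (by fun_prop) (by fun_prop) (fun x' => (hApos _).ne')
    have := this.tendsto x
    simpa [hA0, hB0] using this
  · have : Continuous fun x' : Spc n => A ‖x - x'‖ * mconvW μ (x, t) + B ‖x - x'‖ := by fun_prop
    have := this.tendsto x
    simpa [hA0, hB0] using this

lemma mconvW_continuous {n : ℕ} {μ : Measure (Pt n)} (hμ : PGrowth μ)
    (hfin : ∀ p, eW μ p < ⊤) : Continuous (mconvW μ) := by
  obtain ⟨C, hC, h⟩ := mconvW_time n
  rw [continuous_iff_continuousAt]
  rintro ⟨x, t⟩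
  have h1 : Filter.Tendsto (fun p : Pt n => mconvW μ (p.1, t)) (nhds (x, t)) (nhds (mconvW μ (x, t))) :=
    ((mconvW_continuous_space hμ hfin t).comp continuous_fst).tendsto (x, t)
  have h2 : Filter.Tendsto (fun p : Pt n => mconvW μ p - mconvW μ (p.1, t)) (nhds (x, t)) (nhds 0) := by
    apply squeeze_zero_norm (a := fun p : Pt n => C * √|p.2 - t|)
    · intro p
      exact h μ hμ hfin p.1 p.2 t
    · have : Continuous fun p : Pt n => C * √|p.2 - t| := by fun_prop
      simpa using this.tendsto (x, t)
  have := h2.add h1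
  simpa [ContinuousAt] using this


lemma gradW_bound (n : ℕ) : ∃ C : ℝ, 0 < C ∧ ∀ p : Pt n,
    ‖gradW p‖ₑ ≤ ENNReal.ofReal C * (‖heatW (p.1, p.2 + 1)‖ₑ +
      {q : Pt n | pnorm q < 1}ᶜ.indicator (fun q => ENNReal.ofReal ((pnorm q)⁻¹ ^ (n+2))) p +
      {q : Pt n | pnorm q < 1}.indicator (fun q => ENNReal.ofReal ((pnorm q)⁻¹ ^ (n+1))) p) := by
  obtain ⟨C, hC, h⟩ := heatW_bound n
  refine ⟨2 ^ ((n:ℝ)/2) + C, by positivity, fun p => ?_⟩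
  rcases le_or_gt p.2 0 with hp | hp
  · rw [gradW_nonpos hp]; simp
  have hP := pnorm_pos_of hp
  have hx := norm_le_pnorm p
  rcases le_or_gt 1 p.2 with hp1 | hp1
  · refine le_trans ?_ (mul_le_mul_right (le_trans le_self_add le_self_add) _)
    rw [← ofReal_norm, Real.enorm_of_nonneg (heatW_nonneg _), ← ENNReal.ofReal_mul (by positivity)]
    apply ENNReal.ofReal_le_ofReal
    rw [norm_gradW hp]
    set v := ‖p.1‖ / (2 * p.2) with hv
    have hv0 : 0 ≤ v := by positivity
    have h1 : v * heatW p ≤ 2 ^ ((n:ℝ)/2) * heatW (p.1, p.2 + 1) := by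
      rw [heatW_eq hp, heatW_eq (p := (p.1, p.2 + 1)) (by simp only; linarith)]
      simp only
      have e1 : (4 * π * p.2) ^ (-(n:ℝ)/2) ≤ 2 ^ ((n:ℝ)/2) * (4 * π * (p.2 + 1)) ^ (-(n:ℝ)/2) := by
        have h1 : (2:ℝ) ^ ((n:ℝ)/2) = ((2:ℝ)⁻¹) ^ (-(n:ℝ)/2) := by
          rw [neg_div, Real.rpow_neg (by positivity), Real.inv_rpow (by positivity), inv_inv]
        rw [h1, ← Real.mul_rpow (by positivity) (by positivity)]
        apply Real.rpow_le_rpow_of_nonpos (by positivity)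
        · nlinarith [Real.pi_pos]
        · apply div_nonpos_of_nonpos_of_nonneg <;> simp
      have e2 : v * Real.exp (-‖p.1‖ ^ 2 / (4 * p.2)) ≤ Real.exp (-‖p.1‖ ^ 2 / (4 * (p.2 + 1))) := by
        have a1 : -‖p.1‖ ^ 2 / (4 * (p.2 + 1)) = -‖p.1‖ ^ 2 / (4 * p.2) + v ^ 2 * (p.2 / (p.2 + 1)) := by
          rw [hv]; field_simp; ring
        have a2 : 1 / 2 ≤ p.2 / (p.2 + 1) := by
          rw [div_le_div_iff₀ (by norm_num) (by positivity)]; linarith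
        rw [a1, Real.exp_add, mul_comm]
        gcongr
        have a3 := Real.add_one_le_exp (v ^ 2 * (p.2 / (p.2 + 1)))
        have a4 : v ^ 2 * (1/2) ≤ v ^ 2 * (p.2 / (p.2 + 1)) := by gcongr
        nlinarith [sq_nonneg (v - 1)]
      calc _ = (4 * π * p.2) ^ (-(n:ℝ)/2) * (v * Real.exp (-‖p.1‖ ^ 2 / (4 * p.2))) := by ring
        _ ≤ (2 ^ ((n:ℝ)/2) * (4 * π * (p.2 + 1)) ^ (-(n:ℝ)/2)) * Real.exp (-‖p.1‖ ^ 2 / (4 * (p.2 + 1))) := by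
            gcongr
        _ = _ := by ring
    refine h1.trans ?_
    gcongr
    · exact heatW_nonneg _
    · linarith
  · have hg : ‖gradW p‖ ≤ C * p.2 * pnorm p ^ 1 / pnorm p ^ (n+4) := by
      rw [norm_gradW hp]
      calc ‖p.1‖ / (2 * p.2) * heatW p ≤ pnorm p / (2 * p.2) * (C * p.2 ^ 2 / pnorm p ^ (n+4)) := by
            gcongr
            · exact heatW_nonneg _
            · exact h p hp
        _ = (1/2) * (C * p.2 * pnorm p ^ 1 / pnorm p ^ (n+4)) := by field_simp
        _ ≤ _ := by
            have : 0 ≤ C * p.2 * pnorm p ^ 1 / pnorm p ^ (n+4) := by positivity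
            linarith
    have ht : p.2 ≤ pnorm p ^ 2 := by
      have := abs_le_pnorm_sq p; rwa [abs_of_pos hp] at this
    rcases lt_or_ge (pnorm p) 1 with hc | hc
    · refine le_trans ?_ (mul_le_mul_right le_add_self _)
      rw [indicator_of_mem (by exact hc), ← ofReal_norm, ← ENNReal.ofReal_mul (by positivity)]
      apply ENNReal.ofReal_le_ofReal
      refine hg.trans ?_
      calc C * p.2 * pnorm p ^ 1 / pnorm p ^ (n+4) ≤ C * pnorm p ^ 2 * pnorm p ^ 1 / pnorm p ^ (n+4) := by gcongr
        _ = C * (pnorm p)⁻¹ ^ (n+1) := by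
            rw [inv_pow, show n + 4 = (n + 1) + 3 by ring, pow_add _ (n+1) 3]; field_simp
        _ ≤ _ := by
            gcongr
            have : (0:ℝ) ≤ 2 ^ ((n:ℝ)/2) := by positivity
            linarith
    · refine le_trans ?_ (mul_le_mul_right (le_trans le_add_self le_self_add) _)
      rw [indicator_of_mem (by simpa using hc), ← ofReal_norm, ← ENNReal.ofReal_mul (by positivity)]
      apply ENNReal.ofReal_le_ofReal
      refine hg.trans ?_
      calc C * p.2 * pnorm p ^ 1 / pnorm p ^ (n+4) ≤ C * pnorm p * pnorm p ^ 1 / pnorm p ^ (n+4) := by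
            gcongr; linarith
        _ = C * (pnorm p)⁻¹ ^ (n+2) := by
            rw [inv_pow, show n + 4 = (n + 2) + 2 by ring, pow_add _ (n+2) 2]; field_simp
        _ ≤ _ := by
            gcongr
            have : (0:ℝ) ≤ 2 ^ ((n:ℝ)/2) := by positivity
            linarith

lemma pball_mem_nhds {n : ℕ} (c : Pt n) {r : ℝ} (hr : 0 < r) : pball c r ∈ nhds c := by
  apply IsOpen.mem_nhds
  · exact isOpen_lt (by fun_prop) continuous_const
  · show pnorm (c - c) < r
    simpa [pnorm] using hr

lemma sigmaFinite_of_growth {n : ℕ} {μ : Measure (Pt n)} (hμ : PGrowth μ) : SigmaFinite μ := by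
  have : IsLocallyFiniteMeasure μ := ⟨fun p => ⟨pball p 1, pball_mem_nhds p one_pos,
    (hμ p 1 one_pos).trans_lt ENNReal.ofReal_lt_top⟩⟩
  infer_instance

lemma volume_pball_le {n : ℕ} : ∃ A : ENNReal, A ≠ ⊤ ∧ ∀ r : ℝ, 0 < r →
    volume (pball (0 : Pt n) r) ≤ A * ENNReal.ofReal (r ^ (n + 2)) := by
  refine ⟨volume (Metric.ball (0 : Spc n) 1) * 2, ?_, fun r hr => ?_⟩
  · exact ENNReal.mul_ne_top measure_ball_lt_top.ne (by norm_num)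
  have hsub : pball (0 : Pt n) r ⊆ Metric.ball (0 : Spc n) r ×ˢ Ioo (-r^2) (r^2) := by
    intro p hp
    have hp' : pnorm p < r := by simpa [pball] using hp
    have h1 := norm_le_pnorm p
    have h2 := abs_le_pnorm_sq p
    have h3 : |p.2| < r ^ 2 := by nlinarith [pnorm_nonneg p]
    rw [abs_lt] at h3
    refine ⟨?_, h3⟩
    simp; linarith
  refine (measure_mono hsub).trans ?_
  rw [Measure.volume_eq_prod, Measure.prod_prod, Measure.addHaar_ball_of_pos _ _ hr, Real.volume_Ioo,
    finrank_euclideanSpace, Fintype.card_fin, show r^2 - -r^2 = 2 * r^2 by ring,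
    ENNReal.ofReal_mul (by norm_num), pow_add, ENNReal.ofReal_mul (by positivity)]
  apply le_of_eq
  simp only [ENNReal.ofReal_ofNat]
  ring

/-- Truncated singular kernel. -/
def phiK {n : ℕ} : Pt n → ENNReal :=
  {q : Pt n | pnorm q < 1}.indicator (fun q => ENNReal.ofReal ((pnorm q)⁻¹ ^ (n+1)))

lemma measurableSet_unit {n : ℕ} : MeasurableSet {q : Pt n | pnorm q < 1} :=
  measurableSet_lt (by fun_prop) measurable_const

@[fun_prop]
lemma measurable_phiK {n : ℕ} : Measurable (phiK (n := n)) :=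
  Measurable.indicator (by fun_prop) measurableSet_unit

lemma lintegral_phiK {n : ℕ} : ∫⁻ q : Pt n, phiK q < ⊤ := by
  obtain ⟨A, hA, h⟩ := volume_pball_le (n := n)
  have := near_growth (volume : Measure (Pt n)) 0 A (n+1) h 1 one_pos
  unfold phiK
  rw [lintegral_indicator measurableSet_unit]
  have e : {q : Pt n | pnorm q < 1} = pball 0 1 := by ext q; simp [pball]
  rw [e]
  simp only [zero_sub, pnorm_neg] at this
  exact this.trans_lt (ENNReal.mul_lt_top hA.lt_top ENNReal.ofReal_lt_top)

lemma phiK_ae {n : ℕ} {μ : Measure (Pt n)} (hμ : PGrowth μ) (v : Spc n) :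
    ∀ᵐ p : Pt n, ∫⁻ θ in Icc (0:ℝ) 1, ∫⁻ y, phiK (p + (θ • v, 0) - y) ∂μ < ⊤ := by
  have := sigmaFinite_of_growth hμ
  have hmeas : Measurable fun p : Pt n =>
      ∫⁻ θ in Icc (0:ℝ) 1, ∫⁻ y, phiK (p + (θ • v, 0) - y) ∂μ := by
    apply Measurable.lintegral_prod_right' (f := fun z : Pt n × ℝ => ∫⁻ y, phiK (z.1 + (z.2 • v, 0) - y) ∂μ)
    apply Measurable.lintegral_prod_right' (f := fun z : (Pt n × ℝ) × Pt n => phiK (z.1.1 + (z.1.2 • v, 0) - z.2))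
    fun_prop
  have key : ∀ R : ℕ, ∀ᵐ p : Pt n, p ∈ pball 0 (R:ℝ) →
      ∫⁻ θ in Icc (0:ℝ) 1, ∫⁻ y, phiK (p + (θ • v, 0) - y) ∂μ < ⊤ := by
    intro R
    rw [← ae_restrict_iff' (measurableSet_pball _ _)]
    apply ae_lt_top hmeas
    apply ne_of_lt
    set Big := pball (0 : Pt n) (R + ‖v‖ + 1)
    have hBig : μ Big < ⊤ := (hμ 0 _ (by positivity)).trans_lt ENNReal.ofReal_lt_top
    rw [lintegral_lintegral_swap (by
      apply Measurable.aemeasurable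
      apply Measurable.lintegral_prod_right' (f := fun z : (Pt n × ℝ) × Pt n => phiK (z.1.1 + (z.1.2 • v, 0) - z.2))
      fun_prop)]
    calc _ ≤ ∫⁻ θ in Icc (0:ℝ) 1, (∫⁻ q : Pt n, phiK q) * μ Big := by
          refine setLIntegral_mono' measurableSet_Icc fun θ hθ => ?_
          calc _ ≤ ∫⁻ p in pball (0 : Pt n) R, ∫⁻ y in Big, phiK (p + (θ • v, 0) - y) ∂μ := by
                refine setLIntegral_mono' (measurableSet_pball _ _) fun p hp => ?_
                rw [← lintegral_indicator (measurableSet_pball _ _)]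
                refine lintegral_mono fun y => ?_
                by_cases hy : y ∈ Big
                · rw [indicator_of_mem hy]
                · rw [indicator_of_notMem hy]
                  apply le_of_eq
                  apply indicator_of_notMem
                  intro hcon
                  apply hy
                  have h1 : pnorm (p + (θ • v, 0) - y) < 1 := hcon
                  have h2 : pnorm (p - 0) < R := hp
                  have h3 : pnorm ((θ • v, 0) : Pt n) ≤ ‖v‖ := by
                    apply pnorm_le (norm_nonneg _)
                    · simp only [norm_smul, Real.norm_eq_abs, abs_of_nonneg hθ.1]
                      exact mul_le_of_le_one_left (norm_nonneg _) hθ.2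
                    · simp
                  have h4 := pnorm_add_le (p + (θ • v, 0)) (-(p + (θ • v, 0) - y))
                  have h5 := pnorm_add_le p (θ • v, 0)
                  rw [pnorm_neg] at h4
                  rw [sub_zero] at h2
                  show pnorm (y - 0) < R + ‖v‖ + 1
                  rw [sub_zero]
                  have e : p + (θ • v, 0) + -(p + (θ • v, 0) - y) = y := by abel
                  rw [e] at h4
                  linarith
            _ ≤ ∫⁻ p : Pt n, ∫⁻ y in Big, phiK (p + (θ • v, 0) - y) ∂μ := setLIntegral_le_lintegral _ _
            _ = ∫⁻ y in Big, (∫⁻ p : Pt n, phiK (p + (θ • v, 0) - y)) ∂μ := by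
                rw [lintegral_lintegral_swap (by fun_prop)]
            _ = ∫⁻ y in Big, (∫⁻ q : Pt n, phiK q) ∂μ := by
                congr 1; ext y
                simp_rw [add_sub_assoc]
                have hI : (volume : Measure (Pt n)).IsAddRightInvariant := by
                  rw [Measure.volume_eq_prod]; infer_instance
                exact lintegral_add_right_eq_self phiK _
            _ = _ := by rw [setLIntegral_const]
      _ < ⊤ := by
          rw [setLIntegral_const]
          exact ENNReal.mul_lt_top (ENNReal.mul_lt_top lintegral_phiK hBig) (by simp)
  rw [← ae_all_iff] at key
  filter_upwards [key] with p hp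
  obtain ⟨R, hR⟩ := exists_nat_gt (pnorm p)
  exact hp R (by simpa [pball] using hR)

lemma gradW_ae {n : ℕ} {μ : Measure (Pt n)} (hμ : PGrowth μ) (hfin : ∀ p, eW μ p < ⊤) (v : Spc n) :
    ∀ᵐ p : Pt n, ∫⁻ θ in Icc (0:ℝ) 1, ∫⁻ y, ‖gradW (p + (θ • v, 0) - y)‖ₑ ∂μ < ⊤ := by
  have := sigmaFinite_of_growth hμ
  obtain ⟨C, hC, h⟩ := gradW_bound n
  filter_upwards [phiK_ae hμ v] with p hp
  have hcont := mconvW_continuous hμ hfin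
  have hc2 : Continuous fun θ : ℝ => mconvW μ (p.1 + θ • v, p.2 + 1) := by fun_prop
  obtain ⟨M, hM⟩ := isCompact_Icc.bddAbove_image (hc2.continuousOn (s := Icc (0:ℝ) 1))
  have hb : ∀ θ ∈ Icc (0:ℝ) 1, ∫⁻ y, ‖gradW (p + (θ • v, 0) - y)‖ₑ ∂μ ≤
      ENNReal.ofReal C * (ENNReal.ofReal M + ENNReal.ofReal (2 ^ (n+2) * 1⁻¹) +
        ∫⁻ y, phiK (p + (θ • v, 0) - y) ∂μ) := by
    intro θ hθ
    set q := p + (θ • v, 0) with hq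
    have hq1 : eW μ (q.1, q.2 + 1) ≤ ENNReal.ofReal M := by
      rw [← ENNReal.ofReal_toReal (hfin (q.1, q.2 + 1)).ne, ← mconvW_eq_eW]
      apply ENNReal.ofReal_le_ofReal
      have := hM (mem_image_of_mem _ hθ)
      simpa [hq] using this
    have hfar := far_growth μ q 1 (n+1) (fun r hr => by simpa using hμ q r hr) 1 one_pos
    calc _ ≤ ∫⁻ y, ENNReal.ofReal C * (‖heatW ((q.1, q.2 + 1) - y)‖ₑ +
          (pball q 1)ᶜ.indicator (fun y => ENNReal.ofReal ((pnorm (q - y))⁻¹ ^ (n+2))) y +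
          phiK (q - y)) ∂μ := by
          refine lintegral_mono fun y => ?_
          refine (h (q - y)).trans (le_of_eq ?_)
          congr 2
          congr 1
          · congr 2
            ext <;> simp
            ring
          · by_cases hy : pnorm (q - y) < 1
            · rw [indicator_of_notMem (by simpa using hy), indicator_of_notMem]
              simp only [pball, mem_compl_iff, mem_ofPred_eq, not_not]
              rwa [pnorm_sub_comm]
            · rw [indicator_of_mem (by simpa using hy), indicator_of_mem]
              simp only [pball, mem_compl_iff, mem_ofPred_eq]
              rwa [pnorm_sub_comm]
      _ = ENNReal.ofReal C * (eW μ (q.1, q.2 + 1) +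
            ∫⁻ y in (pball q 1)ᶜ, ENNReal.ofReal ((pnorm (q - y))⁻¹ ^ (n+2)) ∂μ +
            ∫⁻ y, phiK (q - y) ∂μ) := by
          have m1 : Measurable fun y => (pball q 1)ᶜ.indicator (fun y => ENNReal.ofReal ((pnorm (q - y))⁻¹ ^ (n+2))) y :=
            Measurable.indicator (by fun_prop) (measurableSet_pball _ _).compl
          rw [lintegral_const_mul _ (by fun_prop), lintegral_add_left (by fun_prop),
            lintegral_add_left (by fun_prop), lintegral_indicator (measurableSet_pball _ _).compl, eW]
      _ ≤ _ := by
          gcongr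
          simpa using hfar
  refine (setLIntegral_mono' measurableSet_Icc hb).trans_lt ?_
  rw [lintegral_const_mul' _ _ ENNReal.ofReal_ne_top, lintegral_add_left (by fun_prop), setLIntegral_const]
  refine ENNReal.mul_lt_top ENNReal.ofReal_lt_top (ENNReal.add_lt_top.2 ⟨?_, hp⟩)
  refine ENNReal.mul_lt_top (ENNReal.add_lt_top.2 ⟨ENNReal.ofReal_lt_top, ENNReal.ofReal_lt_top⟩) (by simp)

lemma heatW_ftc {n : ℕ} (p : Pt n) (v : Spc n) :
    heatW (p + (v, 0)) - heatW p = ∫ θ in Icc (0:ℝ) 1, inner ℝ (gradW (p + (θ • v, 0))) v := by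
  rcases le_or_gt p.2 0 with hp | hp
  · rw [heatW_nonpos hp, heatW_nonpos (by simpa using hp)]
    have : ∀ θ : ℝ, gradW (p + (θ • v, 0)) = 0 := fun θ => gradW_nonpos (by simpa using hp)
    simp [this]
  have hp' : ∀ w : Spc n, 0 < (p + (w, 0)).2 := fun w => by simpa using hp
  set A := (4 * π * p.2) ^ (-(n : ℝ) / 2) with hA
  have hd : ∀ θ : ℝ, HasDerivAt (fun θ : ℝ => heatW (p + (θ • v, 0)))
      (inner ℝ (gradW (p + (θ • v, 0))) v) θ := by
    intro θ
    have e1 : (fun θ : ℝ => heatW (p + (θ • v, 0))) =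
        fun θ : ℝ => A * Real.exp (-‖p.1 + θ • v‖ ^ 2 / (4 * p.2)) := by
      ext θ; rw [heatW_eq (hp' _)]; simp [hA]
    rw [e1]
    have h1 : HasDerivAt (fun θ : ℝ => p.1 + θ • v) v θ := by
      simpa using ((hasDerivAt_id θ).smul_const v).const_add p.1
    have h2 := (((h1.norm_sq.neg).div_const (4 * p.2)).exp).const_mul A
    refine h2.congr_deriv ?_
    symm
    simp only [gradW, hp' _, if_true, inner_smul_left]
    simp [hA]
    field_simp
    ring
  have hcont : Continuous fun θ : ℝ => inner ℝ (gradW (p + (θ • v, 0))) v := by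
    simp only [gradW, hp' _, if_true]
    simp only [Prod.snd_add, add_zero, Prod.fst_add]
    fun_prop
  rw [integral_Icc_eq_integral_Ioc, ← intervalIntegral.integral_of_le zero_le_one,
    intervalIntegral.integral_eq_sub_of_hasDerivAt (fun θ _ => hd θ) (hcont.intervalIntegrable _ _)]
  have : p + (0, 0) = p := add_zero p
  simp [this]

lemma mconvW_lip_ae {n : ℕ} {μ : Measure (Pt n)} (hμ : PGrowth μ) (hfin : ∀ p, eW μ p < ⊤)
    (hg : ∀ p, ‖mconvGradW μ p‖ ≤ 1) (v : Spc n) :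
    ∀ᵐ p : Pt n, |mconvW μ (p + (v, 0)) - mconvW μ p| ≤ ‖v‖ := by
  have := sigmaFinite_of_growth hμ
  filter_upwards [gradW_ae hμ hfin v] with p hp
  have hInt : Integrable (Function.uncurry fun (y : Pt n) (θ : ℝ) => inner ℝ (gradW (p + (θ • v, 0) - y)) v)
      (μ.prod (volume.restrict (Icc (0:ℝ) 1))) := by
    have hm : Measurable (Function.uncurry fun (y : Pt n) (θ : ℝ) => inner ℝ (gradW (p + (θ • v, 0) - y)) v) := by
      unfold Function.uncurry
      apply Measurable.inner _ measurable_const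
      fun_prop
    refine ⟨hm.aestronglyMeasurable, ?_⟩
    unfold HasFiniteIntegral
    rw [lintegral_prod_symm _ (by fun_prop)]
    calc _ ≤ ∫⁻ θ in Icc (0:ℝ) 1, ∫⁻ y, ‖gradW (p + (θ • v, 0) - y)‖ₑ * ‖v‖ₑ ∂μ := by
          refine lintegral_mono fun θ => lintegral_mono fun y => ?_
          simp only [Function.uncurry]
          rw [← ofReal_norm, ← ofReal_norm, ← ofReal_norm, ← ENNReal.ofReal_mul (norm_nonneg _)]
          exact ENNReal.ofReal_le_ofReal (norm_inner_le_norm _ _)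
      _ = (∫⁻ θ in Icc (0:ℝ) 1, ∫⁻ y, ‖gradW (p + (θ • v, 0) - y)‖ₑ ∂μ) * ‖v‖ₑ := by
          rw [← lintegral_mul_const' _ _ enorm_ne_top]
          congr 1; ext θ
          rw [lintegral_mul_const' _ _ enorm_ne_top]
      _ < ⊤ := ENNReal.mul_lt_top hp enorm_lt_top
  have e : mconvW μ (p + (v, 0)) - mconvW μ p =
      ∫ θ in Icc (0:ℝ) 1, ∫ y, inner ℝ (gradW (p + (θ • v, 0) - y)) v ∂μ := by
    rw [← integral_integral_swap hInt]
    unfold mconvW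
    rw [← integral_sub (integrable_of_eW (hfin _)) (integrable_of_eW (hfin _))]
    congr 1; ext y
    have := heatW_ftc (p - y) v
    rw [show p + (v, 0) - y = p - y + (v, 0) by abel, this]
    congr 1; ext θ
    rw [show p + (θ • v, 0) - y = p - y + (θ • v, 0) by abel]
  have hm2 : Measurable fun θ : ℝ => ∫⁻ y, ‖gradW (p + (θ • v, 0) - y)‖ₑ ∂μ := by
    apply Measurable.lintegral_prod_right' (f := fun z : ℝ × Pt n => ‖gradW (p + (z.1 • v, 0) - z.2)‖ₑ)
    fun_prop
  rw [e, ← Real.norm_eq_abs]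
  have hbound := norm_setIntegral_le_of_norm_le_const_ae' (μ := volume) (s := Icc (0:ℝ) 1) (C := ‖v‖)
    (f := fun θ => ∫ y, inner ℝ (gradW (p + (θ • v, 0) - y)) v ∂μ) (by simp) (by
      rw [← ae_restrict_iff' measurableSet_Icc]
      filter_upwards [ae_lt_top hm2 hp.ne] with θ hθ
      have hi : Integrable (fun y => gradW (p + (θ • v, 0) - y)) μ :=
        ⟨Measurable.aestronglyMeasurable (by fun_prop), hθ⟩
      have e2 : ∫ y, inner ℝ (gradW (p + (θ • v, 0) - y)) v ∂μ = inner ℝ (mconvGradW μ (p + (θ • v, 0))) v := by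
        unfold mconvGradW
        rw [real_inner_comm, ← integral_inner hi]
        congr 1; ext y; rw [real_inner_comm]
      rw [e2]
      refine (norm_inner_le_norm _ _).trans ?_
      exact mul_le_of_le_one_left (norm_nonneg _) (hg _))
  simpa using hbound

lemma mconvW_lip {n : ℕ} {μ : Measure (Pt n)} (hμ : PGrowth μ) (hfin : ∀ p, eW μ p < ⊤)
    (hg : ∀ p, ‖mconvGradW μ p‖ ≤ 1) (x x' : Spc n) (t : ℝ) :
    |mconvW μ (x, t) - mconvW μ (x', t)| ≤ ‖x - x'‖ := by
  have hc := mconvW_continuous hμ hfin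
  have hclosed : IsClosed {p : Pt n | |mconvW μ (p + (x - x', 0)) - mconvW μ p| ≤ ‖x - x'‖} :=
    isClosed_le (by fun_prop) continuous_const
  have hd := (Measure.dense_of_ae (mconvW_lip_ae hμ hfin hg (x - x')))
  have := hclosed.closure_eq ▸ hd.closure_eq
  have hmem : (x', t) ∈ {p : Pt n | |mconvW μ (p + (x - x', 0)) - mconvW μ p| ≤ ‖x - x'‖} := by
    rw [this]; trivial
  simpa using hmem


lemma integral_heatW {n : ℕ} {t : ℝ} (ht : 0 < t) : ∫ x : Spc n, heatW (x, t) = 1 := by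
  have h1 : ∀ x : Spc n, heatW (x, t) =
      (4 * π * t) ^ (-(n : ℝ) / 2) * Real.exp (-(1/(4*t)) * ‖x‖ ^ 2) := by
    intro x
    rw [heatW_eq (p := (x, t)) ht]
    congr 2
    simp only
    field_simp
  simp_rw [h1]
  rw [integral_const_mul, GaussianFourier.integral_rexp_neg_mul_sq_norm (by positivity)]
  rw [finrank_euclideanSpace_fin]
  have e : π / (1 / (4 * t)) = 4 * π * t := by field_simp
  rw [e, ← Real.rpow_add (by positivity)]
  rw [neg_div, neg_add_cancel, Real.rpow_zero]

lemma integrable_heatW {n : ℕ} {t : ℝ} (ht : 0 < t) : Integrable fun x : Spc n => heatW (x, t) := by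
  by_contra h
  have := integral_heatW (n := n) ht
  rw [integral_undef h] at this
  norm_num at this

lemma heatL1_aux {n : ℕ} {a b : ℝ} (ha : 0 < a) (hab : a < b) :
    ∫ x : Spc n, |heatW (x, a) - heatW (x, b)| ≤ 2 * (n * ((b - a) / b)) := by
  set q := (a / b) ^ ((n : ℝ) / 2) with hq
  have hb := ha.trans hab
  have hq1 : q ≤ 1 := Real.rpow_le_one (by positivity) ((div_le_one hb).2 hab.le) (by positivity)
  have hA := integrable_heatW (n := n) ha
  have hB := integrable_heatW (n := n) hb
  calc _ ≤ ∫ x : Spc n, ((heatW (x, b) - q * heatW (x, a)) + (1 - q) * heatW (x, a)) := by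
        refine integral_mono (hA.sub hB).abs ((hB.sub (hA.const_mul q)).add (hA.const_mul _)) fun x => ?_
        have h1 := heatW_time_mono x ha hab
        have h2 := heatW_nonneg (x, a)
        simp only
        rw [← hq] at h1
        rw [abs_le]
        constructor <;> nlinarith
    _ = 2 * (1 - q) := by
        rw [integral_add (f := fun x : Spc n => heatW (x, b) - q * heatW (x, a)) (hB.sub (hA.const_mul q)) (hA.const_mul _), integral_sub hB (hA.const_mul q),
          integral_const_mul, integral_const_mul, integral_heatW ha, integral_heatW hb]
        ring
    _ ≤ _ := by
        have := one_sub_rpow_le (n := n) ha hab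
        linarith

lemma heatL1_lt {n : ℕ} {a b : ℝ} (hab : a < b) :
    ∫⁻ x : Spc n, ‖heatW (x, a) - heatW (x, b)‖ₑ ≤
      ENNReal.ofReal (2 * (n+1) * (|b - a| ^ (3/4:ℝ) * |b| ^ (-(3/4) : ℝ))) := by
  rcases le_or_gt b 0 with hb | hb
  · have : ∀ x : Spc n, ‖heatW (x, a) - heatW (x, b)‖ₑ = 0 := fun x => by
      rw [heatW_nonpos (p := (x,a)) (by simp only; linarith), heatW_nonpos (p := (x,b)) hb]; simp
    simp [this]
  have e : |b - a| ^ (3/4:ℝ) * |b| ^ (-(3/4) : ℝ) = ((b-a)/b) ^ (3/4:ℝ) := by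
    rw [abs_of_pos hb, abs_of_pos (sub_pos.2 hab), Real.div_rpow (by linarith) hb.le,
      Real.rpow_neg hb.le, ← div_eq_mul_inv]
  rw [e]
  rcases le_or_gt a 0 with ha | ha
  · have h1 : ∀ x : Spc n, ‖heatW (x, a) - heatW (x, b)‖ₑ = ENNReal.ofReal (heatW (x, b)) := fun x => by
      rw [heatW_nonpos (p := (x,a)) ha, zero_sub, enorm_neg, Real.enorm_of_nonneg (heatW_nonneg _)]
    simp_rw [h1]
    rw [← ofReal_integral_eq_lintegral_ofReal (integrable_heatW hb) (.of_forall fun x => heatW_nonneg _),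
      integral_heatW hb]
    apply ENNReal.ofReal_le_ofReal
    have : 1 ≤ ((b-a)/b) ^ (3/4:ℝ) := Real.one_le_rpow (by rw [le_div_iff₀ hb]; linarith) (by norm_num)
    have hn : (0:ℝ) ≤ n := by positivity
    nlinarith
  · have hInt : Integrable (fun x : Spc n => heatW (x, a) - heatW (x, b)) := (integrable_heatW (n := n) ha).sub (integrable_heatW (n := n) hb)
    have h1 : ∀ x : Spc n, ‖heatW (x, a) - heatW (x, b)‖ₑ =
        ENNReal.ofReal |heatW (x, a) - heatW (x, b)| := fun x => by
      rw [Real.enorm_eq_ofReal_abs]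
    simp_rw [h1]
    rw [← ofReal_integral_eq_lintegral_ofReal hInt.abs (.of_forall fun x => abs_nonneg _)]
    apply ENNReal.ofReal_le_ofReal
    refine (heatL1_aux ha hab).trans ?_
    have hu0 : 0 < (b-a)/b := div_pos (by linarith) hb
    have hu1 : (b-a)/b ≤ 1 := by rw [div_le_one hb]; linarith
    have : (b-a)/b ≤ ((b-a)/b) ^ (3/4:ℝ) := by
      conv_lhs => rw [← Real.rpow_one ((b-a)/b)]
      exact Real.rpow_le_rpow_of_exponent_ge hu0 hu1 (by norm_num)
    have hn : (0:ℝ) ≤ n := by positivity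
    nlinarith [mul_le_mul_of_nonneg_left this hn]

lemma heatL1 {n : ℕ} (a b : ℝ) :
    ∫⁻ x : Spc n, ‖heatW (x, a) - heatW (x, b)‖ₑ ≤
      ENNReal.ofReal (2 * (n+1) * (|b - a| ^ (3/4:ℝ) * (|a| ^ (-(3/4) : ℝ) + |b| ^ (-(3/4) : ℝ)))) := by
  rcases lt_trichotomy a b with h | h | h
  · refine (heatL1_lt h).trans (ENNReal.ofReal_le_ofReal ?_)
    gcongr
    exact le_add_of_nonneg_left (by positivity)
  · subst h; simp
  · simp_rw [fun x : Spc n => enorm_sub_rev (heatW (x, a)) (heatW (x, b))]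
    refine (heatL1_lt h).trans (ENNReal.ofReal_le_ofReal ?_)
    rw [abs_sub_comm a b]
    gcongr
    exact le_add_of_nonneg_right (by positivity)

lemma lint_rpow_pos {α R : ℝ} (hα : α < 1) (hR : 0 < R) :
    ∫⁻ u in Ioc 0 R, ENNReal.ofReal (|u| ^ (-α)) ≤ ENNReal.ofReal (R ^ (1 - α) / (1 - α)) := by
  have hi : IntervalIntegrable (fun u : ℝ => u ^ (-α)) volume 0 R :=
    intervalIntegral.intervalIntegrable_rpow' (by linarith)
  have hv := integral_rpow (a := 0) (b := R) (r := -α) (Or.inl (by linarith))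
  rw [intervalIntegral.integral_of_le hR.le] at hv
  rw [intervalIntegrable_iff_integrableOn_Ioc_of_le hR.le] at hi
  have e : ∫⁻ u in Ioc 0 R, ENNReal.ofReal (|u| ^ (-α)) = ∫⁻ u in Ioc 0 R, ENNReal.ofReal (u ^ (-α)) := by
    refine setLIntegral_congr_fun measurableSet_Ioc fun u hu => ?_
    show ENNReal.ofReal (|u| ^ (-α)) = _
    rw [abs_of_pos hu.1]
  rw [e, ← ofReal_integral_eq_lintegral_ofReal hi, hv]
  · apply le_of_eq
    rw [Real.zero_rpow (by linarith), show -α + 1 = 1 - α by ring, sub_zero]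
  · refine (ae_restrict_mem measurableSet_Ioc).mono fun u hu => ?_
    exact Real.rpow_nonneg hu.1.le _

lemma lint_rpow_zero {α R : ℝ} (hα : α < 1) (hR : 0 < R) (h0 : 0 ≤ α) :
    ∫⁻ u in Ioo (-R) R, ENNReal.ofReal (|u| ^ (-α)) ≤ ENNReal.ofReal (2 * (R ^ (1 - α) / (1 - α))) := by
  have hsub : Ioo (-R) R ⊆ (Ico (-R) 0 ∪ {0}) ∪ Ioc 0 R := by
    intro u hu
    rcases lt_trichotomy u 0 with h | h | h
    · exact Or.inl (Or.inl ⟨hu.1.le, h⟩)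
    · exact Or.inl (Or.inr h)
    · exact Or.inr ⟨h, hu.2.le⟩
  have hneg : ∫⁻ u in Ico (-R) 0, ENNReal.ofReal (|u| ^ (-α)) =
      ∫⁻ u in Ioc 0 R, ENNReal.ofReal (|u| ^ (-α)) := by
    have := (Measure.measurePreserving_neg (volume : Measure ℝ)).setLIntegral_comp_preimage
      (s := Ico (-R) 0) measurableSet_Ico (f := fun u => ENNReal.ofReal (|u| ^ (-α))) (by fun_prop)
    rw [← this]
    simp
  calc _ ≤ _ := lintegral_mono_set hsub
    _ ≤ _ := lintegral_union_le _ _ _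
    _ ≤ _ := add_le_add (lintegral_union_le _ _ _) le_rfl
    _ = (∫⁻ u in Ioc 0 R, ENNReal.ofReal (|u| ^ (-α))) + ∫⁻ u in Ioc 0 R, ENNReal.ofReal (|u| ^ (-α)) := by
        rw [hneg]; simp
    _ ≤ _ := add_le_add (lint_rpow_pos hα hR) (lint_rpow_pos hα hR)
    _ = _ := by
        have : 0 ≤ R ^ (1 - α) / (1 - α) := div_nonneg (by positivity) (by linarith)
        rw [← ENNReal.ofReal_add this this]
        ring_nf

lemma lint_rpow {α R : ℝ} (hα : α < 1) (hR : 0 < R) (h0 : 0 ≤ α) (c r : ℝ) :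
    ∫⁻ u in Ioo (c - R) (c + R), ENNReal.ofReal (|u - r| ^ (-α)) ≤
      ENNReal.ofReal ((2 / (1 - α) + 2) * R ^ (1 - α)) := by
  have h1 : ∫⁻ u in Ioo (r - R) (r + R), ENNReal.ofReal (|u - r| ^ (-α)) =
      ∫⁻ u in Ioo (-R) R, ENNReal.ofReal (|u| ^ (-α)) := by
    have := (measurePreserving_sub_right (volume : Measure ℝ) r).setLIntegral_comp_preimage
      (s := Ioo (-R) R) measurableSet_Ioo (f := fun u => ENNReal.ofReal (|u| ^ (-α))) (by fun_prop)
    rw [← this]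
    congr 2
    ext u
    simp only [mem_preimage, mem_Ioo]
    constructor <;> rintro ⟨h1, h2⟩ <;> constructor <;> linarith
  have hsub : Ioo (c - R) (c + R) ⊆ Ioo (r - R) (r + R) ∪ (Ioo (c - R) (c + R) \ Ioo (r - R) (r + R)) := by
    intro u hu; by_cases h : u ∈ Ioo (r - R) (r + R)
    · exact Or.inl h
    · exact Or.inr ⟨hu, h⟩
  have h2 : ∫⁻ u in (Ioo (c - R) (c + R) \ Ioo (r - R) (r + R)), ENNReal.ofReal (|u - r| ^ (-α)) ≤
      ENNReal.ofReal (2 * R ^ (1 - α)) := by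
    calc _ ≤ ∫⁻ u in (Ioo (c - R) (c + R) \ Ioo (r - R) (r + R)), ENNReal.ofReal (R ^ (-α)) := by
          refine setLIntegral_mono' (measurableSet_Ioo.diff measurableSet_Ioo) fun u hu => ?_
          apply ENNReal.ofReal_le_ofReal
          apply Real.rpow_le_rpow_of_nonpos hR _ (by linarith)
          by_contra! h
          exact hu.2 ⟨by linarith [(abs_lt.1 h).1], by linarith [(abs_lt.1 h).2]⟩
      _ ≤ ∫⁻ u in Ioo (c - R) (c + R), ENNReal.ofReal (R ^ (-α)) := lintegral_mono_set sdiff_subset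
      _ = _ := by
          rw [setLIntegral_const, Real.volume_Ioo, ← ENNReal.ofReal_mul (by positivity)]
          congr 1
          rw [show 1 - α = -α + 1 by ring, Real.rpow_add_one hR.ne']
          ring
  calc _ ≤ _ := lintegral_mono_set hsub
    _ ≤ _ := lintegral_union_le _ _ _
    _ ≤ _ := add_le_add (h1.trans_le (lint_rpow_zero hα hR h0)) h2
    _ = _ := by
        have : 0 < 1 - α := by linarith
        rw [← ENNReal.ofReal_add (by positivity) (by positivity)]
        congr 1
        field_simp


lemma near_time {R : ℝ} (hR : 0 < R) (c r : ℝ) :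
    ∫⁻ t in Ioo (c - R) (c + R), ∫⁻ s in Ioo (c - R) (c + R),
      ENNReal.ofReal (|s - t| ^ (-(3/4) : ℝ)) *
        (ENNReal.ofReal (|t - r| ^ (-(3/4) : ℝ)) + ENNReal.ofReal (|s - r| ^ (-(3/4) : ℝ))) ≤
      ENNReal.ofReal (200 * √R) := by
  set I := Ioo (c - R) (c + R) with hI
  set A := ENNReal.ofReal (10 * R ^ (1/4:ℝ)) with hA
  have hK : ∀ r, ∫⁻ u in I, ENNReal.ofReal (|u - r| ^ (-(3/4) : ℝ)) ≤ A := by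
    intro r
    have := lint_rpow (α := 3/4) (by norm_num) hR (by norm_num) c r
    convert this using 4 <;> norm_num
  have h1 : ∫⁻ t in I, ∫⁻ s in I, ENNReal.ofReal (|s - t| ^ (-(3/4) : ℝ)) *
      ENNReal.ofReal (|t - r| ^ (-(3/4) : ℝ)) ≤ A * A := by
    calc _ ≤ ∫⁻ t in I, A * ENNReal.ofReal (|t - r| ^ (-(3/4) : ℝ)) := by
          refine lintegral_mono fun t => ?_
          rw [lintegral_mul_const _ (by fun_prop)]
          gcongr
          exact hK t
      _ ≤ _ := by
          rw [lintegral_const_mul _ (by fun_prop)]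
          gcongr
          exact hK r
  have h2 : ∫⁻ t in I, ∫⁻ s in I, ENNReal.ofReal (|s - t| ^ (-(3/4) : ℝ)) *
      ENNReal.ofReal (|s - r| ^ (-(3/4) : ℝ)) ≤ A * A := by
    rw [lintegral_lintegral_swap (by fun_prop)]
    refine le_trans (le_of_eq ?_) h1
    refine lintegral_congr fun t => lintegral_congr fun s => ?_
    rw [abs_sub_comm t s]
  calc _ = (∫⁻ t in I, ∫⁻ s in I, ENNReal.ofReal (|s - t| ^ (-(3/4) : ℝ)) *
      ENNReal.ofReal (|t - r| ^ (-(3/4) : ℝ))) + ∫⁻ t in I, ∫⁻ s in I, ENNReal.ofReal (|s - t| ^ (-(3/4) : ℝ)) *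
      ENNReal.ofReal (|s - r| ^ (-(3/4) : ℝ)) := by
        rw [← lintegral_add_left (by fun_prop)]
        refine lintegral_congr fun t => ?_
        rw [← lintegral_add_left (by fun_prop)]
        simp_rw [mul_add]
    _ ≤ A * A + A * A := add_le_add h1 h2
    _ = _ := by
        rw [hA, ← ENNReal.ofReal_mul (by positivity), ← ENNReal.ofReal_add (by positivity) (by positivity)]
        congr 1
        have : R ^ (1/4:ℝ) * R ^ (1/4:ℝ) = √R := by
          rw [← Real.rpow_add hR, Real.sqrt_eq_rpow]; norm_num
        linear_combination 200 * this

lemma rpow_helper (u : ℝ) : |u| ^ (3/4:ℝ) * |u| ^ (-(3/2):ℝ) = |u| ^ (-(3/4):ℝ) := by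
  rcases eq_or_ne u 0 with rfl | h
  · simp [Real.zero_rpow]
  · rw [← Real.rpow_add (abs_pos.2 h)]; norm_num

lemma rpow_helper2 (u : ℝ) : |u| * |u| ^ (-(3/2):ℝ) = |u| ^ (-(1/2):ℝ) := by
  rcases eq_or_ne u 0 with rfl | h
  · simp [Real.zero_rpow]
  · rw [← Real.rpow_one_add' (abs_nonneg _) (by norm_num)]; norm_num

lemma near_one {n : ℕ} {R : ℝ} (hR : 0 < R) (c : ℝ) (y : Pt n) :
    ∫⁻ t in Ioo (c - R) (c + R), ∫⁻ s in Ioo (c - R) (c + R), ∫⁻ x : Spc n,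
      ‖heatW ((x, t) - y) - heatW ((x, s) - y)‖ₑ * ENNReal.ofReal (|s - t| ^ (-(3/2):ℝ)) ≤
      ENNReal.ofReal (400 * (n+1) * √R) := by
  calc _ ≤ ∫⁻ t in Ioo (c - R) (c + R), ∫⁻ s in Ioo (c - R) (c + R), ENNReal.ofReal (2 * (n+1)) *
      (ENNReal.ofReal (|s - t| ^ (-(3/4) : ℝ)) *
        (ENNReal.ofReal (|t - y.2| ^ (-(3/4) : ℝ)) + ENNReal.ofReal (|s - y.2| ^ (-(3/4) : ℝ)))) := by
        refine lintegral_mono fun t => lintegral_mono fun s => ?_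
        simp only
        rw [lintegral_mul_const _ (by fun_prop)]
        have e : ∫⁻ x : Spc n, ‖heatW ((x, t) - y) - heatW ((x, s) - y)‖ₑ =
            ∫⁻ x : Spc n, ‖heatW (x, t - y.2) - heatW (x, s - y.2)‖ₑ :=
          lintegral_sub_right_eq_self
            (fun x : Spc n => ‖heatW (x, t - y.2) - heatW (x, s - y.2)‖ₑ) y.1
        rw [e]
        refine (mul_le_mul_left (heatL1 _ _) _).trans (le_of_eq ?_)
        rw [← ENNReal.ofReal_mul (by positivity), ← ENNReal.ofReal_add (by positivity) (by positivity),
          ← ENNReal.ofReal_mul (by positivity), ← ENNReal.ofReal_mul (by positivity), ← rpow_helper (s - t)]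
        congr 1
        rw [show s - y.2 - (t - y.2) = s - t by ring]
        ring
    _ = ENNReal.ofReal (2 * (n+1)) * ∫⁻ t in Ioo (c - R) (c + R), ∫⁻ s in Ioo (c - R) (c + R), 
      (ENNReal.ofReal (|s - t| ^ (-(3/4) : ℝ)) *
        (ENNReal.ofReal (|t - y.2| ^ (-(3/4) : ℝ)) + ENNReal.ofReal (|s - y.2| ^ (-(3/4) : ℝ)))) := by
        rw [← lintegral_const_mul _ (by fun_prop)]
        refine lintegral_congr fun t => ?_
        rw [lintegral_const_mul _ (by fun_prop)]
    _ ≤ _ := mul_le_mul_right (near_time hR c y.2) _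
    _ = _ := by
        rw [← ENNReal.ofReal_mul (by positivity)]
        congr 1; ring

lemma near_tonelli {n : ℕ} {μ : Measure (Pt n)} (hμ : PGrowth μ) {R : ℝ} (hR : 0 < R) (c : ℝ)
    (P : Set (Pt n)) :
    ∫⁻ p in (univ : Set (Spc n)) ×ˢ Ioo (c - R) (c + R), ∫⁻ s in Ioo (c - R) (c + R),
      (∫⁻ y in P, ‖heatW ((p.1, p.2) - y) - heatW ((p.1, s) - y)‖ₑ ∂μ) *
        ENNReal.ofReal (|s - p.2| ^ (-(3/2):ℝ)) ≤
      ENNReal.ofReal (400 * (n+1) * √R) * μ P := by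
  have := sigmaFinite_of_growth hμ
  set I := Ioo (c - R) (c + R) with hI
  calc _ = ∫⁻ p in (univ : Set (Spc n)) ×ˢ I, ∫⁻ s in I, ∫⁻ y in P,
        ‖heatW ((p.1, p.2) - y) - heatW ((p.1, s) - y)‖ₑ *
        ENNReal.ofReal (|s - p.2| ^ (-(3/2):ℝ)) ∂μ := by
        refine lintegral_congr fun p => lintegral_congr fun s => ?_
        rw [lintegral_mul_const _ (by fun_prop)]
    _ = ∫⁻ p in (univ : Set (Spc n)) ×ˢ I, ∫⁻ y in P, ∫⁻ s in I, 
        ‖heatW ((p.1, p.2) - y) - heatW ((p.1, s) - y)‖ₑ *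
        ENNReal.ofReal (|s - p.2| ^ (-(3/2):ℝ)) ∂volume ∂μ := by
        refine lintegral_congr fun p => ?_
        rw [lintegral_lintegral_swap (by fun_prop)]
    _ = ∫⁻ y in P, ∫⁻ p in (univ : Set (Spc n)) ×ˢ I, ∫⁻ s in I, 
        ‖heatW ((p.1, p.2) - y) - heatW ((p.1, s) - y)‖ₑ *
        ENNReal.ofReal (|s - p.2| ^ (-(3/2):ℝ)) ∂volume ∂volume ∂μ := by
        rw [lintegral_lintegral_swap]
        refine Measurable.aemeasurable ?_
        refine Measurable.lintegral_prod_right' (f := fun z : (Pt n × Pt n) × ℝ => 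
          ‖heatW ((z.1.1.1, z.1.1.2) - z.1.2) - heatW ((z.1.1.1, z.2) - z.1.2)‖ₑ *
          ENNReal.ofReal (|z.2 - z.1.1.2| ^ (-(3/2):ℝ))) (by fun_prop)
    _ = ∫⁻ y in P, ∫⁻ t in I, ∫⁻ s in I, ∫⁻ x : Spc n,
        ‖heatW ((x, t) - y) - heatW ((x, s) - y)‖ₑ *
        ENNReal.ofReal (|s - t| ^ (-(3/2):ℝ)) ∂volume ∂volume ∂volume ∂μ := by
        refine lintegral_congr fun y => ?_
        rw [Measure.volume_eq_prod, ← Measure.prod_restrict, Measure.restrict_univ, lintegral_prod_symm]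
        · refine lintegral_congr fun t => ?_
          rw [lintegral_lintegral_swap (by fun_prop)]
        · refine Measurable.aemeasurable ?_
          refine Measurable.lintegral_prod_right' (f := fun z : Pt n × ℝ => 
            ‖heatW ((z.1.1, z.1.2) - y) - heatW ((z.1.1, z.2) - y)‖ₑ *
            ENNReal.ofReal (|z.2 - z.1.2| ^ (-(3/2):ℝ))) (by fun_prop)
    _ ≤ ∫⁻ y in P, ENNReal.ofReal (400 * (n+1) * √R) ∂μ := lintegral_mono fun y => near_one hR c y
    _ = _ := by rw [setLIntegral_const]


/-- Base point of a parabolic cube. -/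
def PCube.base {n : ℕ} (Q : PCube n) : Pt n := (WithLp.toLp 2 Q.corner, Q.time)

/-- Time window around a parabolic cube. -/
def PCube.win {n : ℕ} (Q : PCube n) : Set ℝ :=
  Ioo (Q.time - 2 * Q.len ^ 2) (Q.time + 2 * Q.len ^ 2)

lemma PCube.toSet_eq {n : ℕ} (Q : PCube n) : Q.toSet =
    ((MeasurableEquiv.toLp 2 (Fin n → ℝ)).symm ⁻¹'
      (Set.pi univ fun i => Icc (Q.corner i) (Q.corner i + Q.len))) ×ˢ
      Icc Q.time (Q.time + Q.len ^ 2) := by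
  ext p
  simp only [PCube.toSet, mem_prod, mem_preimage, mem_univ_pi]
  rfl

lemma PCube.measurableSet {n : ℕ} (Q : PCube n) : MeasurableSet Q.toSet := by
  rw [Q.toSet_eq]
  refine MeasurableSet.prod ?_ measurableSet_Icc
  exact (MeasurableEquiv.measurable _) (MeasurableSet.univ_pi fun i => measurableSet_Icc)

lemma PCube.volume_eq {n : ℕ} (Q : PCube n) : volume Q.toSet = ENNReal.ofReal (Q.len ^ (n + 2)) := by
  rw [Q.toSet_eq, Measure.volume_eq_prod, Measure.prod_prod,
    (EuclideanSpace.volume_preserving_symm_measurableEquiv_toLp (Fin n)).measure_preimage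
      (MeasurableSet.univ_pi fun i => measurableSet_Icc).nullMeasurableSet, Real.volume_Icc]
  rw [volume_pi_pi]
  simp only [Real.volume_Icc, add_sub_cancel_left, Finset.prod_const, Finset.card_univ, Fintype.card_fin]
  rw [← ENNReal.ofReal_pow Q.len_pos.le, ← ENNReal.ofReal_mul (pow_nonneg Q.len_pos.le _), pow_add]

lemma PCube.norm_sub_le {n : ℕ} (Q : PCube n) {p : Pt n} (hp : p ∈ Q.toSet) :
    ‖p.1 - Q.base.1‖ ≤ (n + 1) * Q.len := by
  have hl := Q.len_pos
  rw [EuclideanSpace.norm_eq]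
  apply Real.sqrt_le_iff.2 ⟨by positivity, ?_⟩
  calc _ ≤ ∑ i : Fin n, Q.len ^ 2 := by
        refine Finset.sum_le_sum fun i _ => ?_
        have := hp.1 i
        have h2 : ‖(p.1 - Q.base.1) i‖ ≤ Q.len := by
          simp only [PCube.base, PiLp.sub_apply, Real.norm_eq_abs]
          rw [abs_le]; constructor <;> linarith [this.1, this.2]
        gcongr
    _ = n * Q.len ^ 2 := by simp
    _ ≤ _ := by
        have hn : (0:ℝ) ≤ n := by positivity
        nlinarith [sq_nonneg Q.len, mul_nonneg hn (sq_nonneg Q.len), mul_nonneg (mul_nonneg hn hn) (sq_nonneg Q.len)]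

lemma PCube.time_mem {n : ℕ} (Q : PCube n) {p : Pt n} (hp : p ∈ Q.toSet) : p.2 ∈ Q.win := by
  have hl := pow_pos Q.len_pos 2
  have := hp.2
  exact ⟨by linarith [this.1], by linarith [this.2]⟩

lemma PCube.pball_sub {n : ℕ} (Q : PCube n) {p : Pt n} (hp : p ∈ Q.toSet) :
    pball p (4 * Q.len) ⊆ pball Q.base ((n + 6) * Q.len) := by
  intro y hy
  have hl := Q.len_pos
  have h1 : pnorm (p - Q.base) ≤ (n + 1) * Q.len := by
    have h0 : (0:ℝ) ≤ (n + 1) * Q.len := by positivity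
    have h4 := Q.norm_sub_le hp
    rw [← Prod.fst_sub] at h4
    refine pnorm_le h0 h4 ?_
    have := hp.2
    have hn : (0:ℝ) ≤ n := by positivity
    have h3 : Q.len ^ 2 ≤ ((n + 1) * Q.len) ^ 2 := by
      gcongr
      nlinarith
    simp only [PCube.base, Prod.snd_sub]
    rw [abs_le]; constructor <;> linarith [this.1, this.2]
  have h2 := pnorm_add_le (y - p) (p - Q.base)
  rw [sub_add_sub_cancel] at h2
  have h3 : pnorm (y - p) < 4 * Q.len := hy
  show pnorm (y - Q.base) < _
  linarith

lemma diff_le {n : ℕ} {μ : Measure (Pt n)} (hfin : ∀ p, eW μ p < ⊤) (x : Spc n) (t s : ℝ) :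
    ‖mconvW μ (x, s) - mconvW μ (x, t)‖ₑ ≤
      ∫⁻ y, ‖heatW ((x, t) - y) - heatW ((x, s) - y)‖ₑ ∂μ := by
  rw [enorm_sub_rev]
  unfold mconvW
  rw [← integral_sub (integrable_of_eW (hfin _)) (integrable_of_eW (hfin _))]
  exact enorm_integral_le_lintegral_enorm _

lemma near_far (n : ℕ) : ∃ C : ℝ, 0 < C ∧ ∀ μ : Measure (Pt n), PGrowth μ →
    ∀ (Q : PCube n) (p : Pt n), p ∈ Q.toSet →
    ∫⁻ s in Q.win, (∫⁻ y in (pball Q.base ((n + 6) * Q.len))ᶜ,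
      ‖heatW ((p.1, p.2) - y) - heatW ((p.1, s) - y)‖ₑ ∂μ) *
        ENNReal.ofReal (|s - p.2| ^ (-(3/2):ℝ)) ≤ ENNReal.ofReal C := by
  obtain ⟨C, hC, h⟩ := far_diff n
  refine ⟨3 * C, by positivity, fun μ hμ Q p hp => ?_⟩
  have hl := Q.len_pos
  calc _ ≤ ∫⁻ s in Q.win, ENNReal.ofReal (C * (4 * Q.len)⁻¹) * ENNReal.ofReal (|s - p.2| ^ (-(1/2):ℝ)) := by
        refine setLIntegral_mono' measurableSet_Ioo fun s hs => ?_
        have h1 : 4 * |p.2 - s| ≤ (4 * Q.len) ^ 2 := by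
          have h2 := hp.2
          have h3 : |p.2 - s| ≤ 3 * Q.len ^ 2 := by
            rw [abs_le]; constructor <;> nlinarith [h2.1, h2.2, hs.1, hs.2]
          nlinarith [sq_nonneg Q.len]
        calc _ ≤ ENNReal.ofReal (C * |p.2 - s| * (4 * Q.len)⁻¹) * ENNReal.ofReal (|s - p.2| ^ (-(3/2):ℝ)) := by
              gcongr
              refine (lintegral_mono_set ?_).trans (h μ hμ p.1 p.2 s (4 * Q.len) (by positivity) h1)
              exact compl_subset_compl.2 (Q.pball_sub hp)
          _ = _ := by
              rw [← ENNReal.ofReal_mul (by positivity), ← ENNReal.ofReal_mul (by positivity),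
                ← rpow_helper2, abs_sub_comm p.2 s]
              congr 1; ring
    _ = ENNReal.ofReal (C * (4 * Q.len)⁻¹) * ∫⁻ s in Q.win, ENNReal.ofReal (|s - p.2| ^ (-(1/2):ℝ)) := by
        rw [lintegral_const_mul _ (by fun_prop)]
    _ ≤ ENNReal.ofReal (C * (4 * Q.len)⁻¹) * ENNReal.ofReal ((2 / (1 - 1/2) + 2) * (2 * Q.len ^ 2) ^ (1 - 1/2 : ℝ)) := by
        gcongr
        exact lint_rpow (by norm_num) (by positivity) (by norm_num) _ _
    _ ≤ _ := by
        rw [← ENNReal.ofReal_mul (by positivity)]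
        apply ENNReal.ofReal_le_ofReal
        have : (2 * Q.len ^ 2) ^ (1 - 1/2 : ℝ) ≤ 2 * Q.len := by
          rw [show (1 - 1/2:ℝ) = 1/2 by norm_num, ← Real.sqrt_eq_rpow]
          apply Real.sqrt_le_iff.2 ⟨by positivity, ?_⟩
          nlinarith [sq_nonneg Q.len]
        calc _ ≤ C * (4 * Q.len)⁻¹ * ((2 / (1 - 1/2) + 2) * (2 * Q.len)) := by gcongr
          _ = _ := by field_simp; norm_num

/-- The near part of the half derivative. -/
def nearN {n : ℕ} (f : Pt n → ℝ) (Q : PCube n) (p : Pt n) : ENNReal :=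
  ∫⁻ s in Q.win, ‖f (p.1, s) - f p‖ₑ * ENNReal.ofReal (|s - p.2| ^ (-(3/2):ℝ))


lemma meas_aux {n : ℕ} {μ : Measure (Pt n)} [SigmaFinite μ] (P : Set (Pt n)) (p : Pt n) :
    Measurable fun s : ℝ => (∫⁻ y in P,
            ‖heatW ((p.1, p.2) - y) - heatW ((p.1, s) - y)‖ₑ ∂μ) *
              ENNReal.ofReal (|s - p.2| ^ (-(3/2):ℝ)) := by
  refine Measurable.mul ?_ (by fun_prop)
  exact Measurable.lintegral_prod_right' (f := fun z : ℝ × Pt n => 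
          ‖heatW ((p.1, p.2) - z.2) - heatW ((p.1, z.1) - z.2)‖ₑ) (by fun_prop)

lemma nearN_bound (n : ℕ) : ∃ C : ℝ, 0 < C ∧ ∀ μ : Measure (Pt n), PGrowth μ →
    (∀ p, eW μ p < ⊤) → ∀ Q : PCube n,
    ∫⁻ p in Q.toSet, nearN (mconvW μ) Q p ≤ ENNReal.ofReal (C * Q.len ^ (n + 2)) := by
  obtain ⟨C, hC, h⟩ := near_far n
  refine ⟨800 * (n+1) * (n+6)^(n+1) + C, by positivity, fun μ hμ hfin Q => ?_⟩
  have := sigmaFinite_of_growth hμ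
  have hl := Q.len_pos
  set P := pball Q.base ((n + 6) * Q.len) with hP
  have hPm : MeasurableSet P := measurableSet_pball _ _
  set G : Set (Pt n) → Pt n → ENNReal := fun S p => ∫⁻ s in Q.win, (∫⁻ y in S,
      ‖heatW ((p.1, p.2) - y) - heatW ((p.1, s) - y)‖ₑ ∂μ) *
        ENNReal.ofReal (|s - p.2| ^ (-(3/2):ℝ)) with hG
  have hmeas : ∀ S, Measurable fun z : Pt n × ℝ => (∫⁻ y in S,
      ‖heatW ((z.1.1, z.1.2) - y) - heatW ((z.1.1, z.2) - y)‖ₑ ∂μ) *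
        ENNReal.ofReal (|z.2 - z.1.2| ^ (-(3/2):ℝ)) := by
    intro S
    refine Measurable.mul ?_ (by fun_prop)
    exact Measurable.lintegral_prod_right' (f := fun z : (Pt n × ℝ) × Pt n => 
          ‖heatW ((z.1.1.1, z.1.1.2) - z.2) - heatW ((z.1.1.1, z.1.2) - z.2)‖ₑ) (by fun_prop)
  have hGm : ∀ S, Measurable (G S) := fun S => Measurable.lintegral_prod_right' (hmeas S)
  have hR : 0 < 2 * Q.len ^ 2 := by positivity
  have hX1 : ∫⁻ p in Q.toSet, G P p ≤ ∫⁻ p in (univ : Set (Spc n)) ×ˢ Q.win, G P p :=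
    lintegral_mono_set fun p hp => ⟨trivial, Q.time_mem hp⟩
  have hX2 : ∫⁻ p in (univ : Set (Spc n)) ×ˢ Q.win, G P p ≤
      ENNReal.ofReal (400 * (n+1) * √(2 * Q.len ^ 2)) * μ P := near_tonelli hμ hR Q.time P
  have hr : (0:ℝ) < (n + 6) * Q.len := by positivity
  have hX3 : μ P ≤ ENNReal.ofReal (((n + 6) * Q.len) ^ (n+1)) := hμ Q.base ((n + 6) * Q.len) hr
  have hX4 : √(2 * Q.len ^ 2) ≤ 2 * Q.len := by
    apply Real.sqrt_le_iff.2 ⟨by positivity, ?_⟩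
    nlinarith [sq_nonneg Q.len]
  have hX : ∫⁻ p in Q.toSet, G P p ≤ ENNReal.ofReal (800 * (n+1) * (n+6)^(n+1) * Q.len ^ (n+2)) := by
    refine (hX1.trans hX2).trans ?_
    refine (mul_le_mul' (ENNReal.ofReal_le_ofReal (mul_le_mul_of_nonneg_left hX4 (by positivity))) hX3).trans ?_
    rw [← ENNReal.ofReal_mul (by positivity)]
    apply ENNReal.ofReal_le_ofReal
    apply le_of_eq
    rw [mul_pow]; ring
  have hY : ∫⁻ p in Q.toSet, G Pᶜ p ≤ ENNReal.ofReal (C * Q.len ^ (n+2)) := by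
    have : ∫⁻ p in Q.toSet, G Pᶜ p ≤ ∫⁻ p in Q.toSet, ENNReal.ofReal C :=
      setLIntegral_mono' Q.measurableSet fun p hp => h μ hμ Q p hp
    refine this.trans ?_
    rw [setLIntegral_const, Q.volume_eq, ENNReal.ofReal_mul hC.le]
  have hZ : ∀ p, nearN (mconvW μ) Q p ≤ G P p + G Pᶜ p := by
    intro p
    have hm : Measurable fun s : ℝ => (∫⁻ y in P,
            ‖heatW ((p.1, p.2) - y) - heatW ((p.1, s) - y)‖ₑ ∂μ) *
              ENNReal.ofReal (|s - p.2| ^ (-(3/2):ℝ)) :=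
      meas_aux P p
    simp only [hG, nearN]
    rw [← lintegral_add_left hm]
    refine lintegral_mono fun s => ?_
    rw [← add_mul, lintegral_add_compl _ hPm]
    exact mul_le_mul_left (diff_le hfin p.1 p.2 s) _
  refine (lintegral_mono hZ).trans ?_
  rw [lintegral_add_left (hGm P)]
  refine (add_le_add hX hY).trans ?_
  rw [← ENNReal.ofReal_add (by positivity) (by positivity)]
  apply ENNReal.ofReal_le_ofReal
  apply le_of_eq
  ring


lemma real_far {a b l A B K1 K2 : ℝ} (ha : 0 ≤ a) (hb : 0 < b) (hl : 0 < l) (hK1 : 0 ≤ K1) (hK2 : 0 ≤ K2)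
    (h1 : 2 * l ^ 2 ≤ b ^ 2) (h2 : |a ^ 2 - b ^ 2| ≤ l ^ 2) (h3 : |A - B| ≤ K1 * l) (h4 : |B| ≤ K2 * b) :
    |A / a ^ 3 - B / b ^ 3| ≤ (4 * K1 + 16 * K2) * (l * (b ^ 3)⁻¹) := by
  obtain ⟨h5, h6⟩ := abs_le.1 h2
  have ha1 : 2 * b / 3 ≤ a := by
    by_contra! h
    nlinarith
  have ha2 : a ≤ 5 * b / 4 := by
    by_contra! h
    nlinarith
  have ha0 : 0 < a := by linarith
  have hlb : l ≤ b := by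
    by_contra! h
    nlinarith
  have ha3 : b ^ 3 / 4 ≤ a ^ 3 := by
    have : (2 * b / 3) ^ 3 ≤ a ^ 3 := by gcongr
    nlinarith [pow_pos hb 3]
  have hd : |b - a| * b ≤ l ^ 2 := by
    have : |a ^ 2 - b ^ 2| = |b - a| * (a + b) := by
      rw [← abs_of_pos (show 0 < a + b by linarith), ← abs_mul, abs_sub_comm]
      congr 1; ring
    rw [this] at h2
    nlinarith [abs_nonneg (b - a)]
  have hcube : |b ^ 3 - a ^ 3| ≤ 4 * l ^ 2 * b := by
    have e : b ^ 3 - a ^ 3 = (b - a) * (b ^ 2 + a * b + a ^ 2) := by ring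
    have hp : 0 ≤ b ^ 2 + a * b + a ^ 2 := by positivity
    have hp2 : b ^ 2 + a * b + a ^ 2 ≤ 4 * b ^ 2 := by nlinarith
    rw [e, abs_mul, abs_of_nonneg hp]
    calc _ ≤ |b - a| * (4 * b ^ 2) := by gcongr
      _ = 4 * (|b - a| * b) * b := by ring
      _ ≤ 4 * l ^ 2 * b := by gcongr
  have e : A / a ^ 3 - B / b ^ 3 = (A - B) / a ^ 3 + B * (b ^ 3 - a ^ 3) / (a ^ 3 * b ^ 3) := by
    field_simp; ring
  have t1 : |(A - B) / a ^ 3| ≤ K1 * l / (b ^ 3 / 4) := by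
    rw [abs_div, abs_of_pos (pow_pos ha0 3)]
    gcongr
  have t2 : |B * (b ^ 3 - a ^ 3) / (a ^ 3 * b ^ 3)| ≤ (K2 * b) * (4 * l ^ 2 * b) / (b ^ 3 / 4 * b ^ 3) := by
    rw [abs_div, abs_mul, abs_of_pos (show 0 < a ^ 3 * b ^ 3 by positivity)]
    gcongr
  rw [e]
  refine (abs_add_le _ _).trans ((add_le_add t1 t2).trans ?_)
  have e1 : K1 * l / (b ^ 3 / 4) = 4 * K1 * (l * (b ^ 3)⁻¹) := by field_simp
  have e2 : (K2 * b) * (4 * l ^ 2 * b) / (b ^ 3 / 4 * b ^ 3) = 16 * K2 * (l * (b ^ 3)⁻¹) * (l / b) := by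
    field_simp; ring
  have h7 : l / b ≤ 1 := (div_le_one hb).2 hlb
  have h8 : 16 * K2 * (l * (b ^ 3)⁻¹) * (l / b) ≤ 16 * K2 * (l * (b ^ 3)⁻¹) * 1 := by gcongr
  rw [e1, e2]
  linarith

lemma rpow32 (u : ℝ) : |u| ^ (3/2:ℝ) = √|u| ^ 3 := by
  rw [Real.sqrt_eq_rpow, ← Real.rpow_natCast, ← Real.rpow_mul (abs_nonneg _)]
  norm_num

lemma far_pt (n : ℕ) : ∃ C : ℝ, 0 < C ∧ ∀ μ : Measure (Pt n), PGrowth μ →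
    (∀ p, eW μ p < ⊤) → (∀ p, ‖mconvGradW μ p‖ ≤ 1) → ∀ (Q : PCube n), ∀ p ∈ Q.toSet, ∀ s ∉ Q.win,
    |(mconvW μ (p.1, s) - mconvW μ p) / |s - p.2| ^ (3/2:ℝ) -
      (mconvW μ (Q.base.1, s) - mconvW μ Q.base) / |s - Q.base.2| ^ (3/2:ℝ)| ≤
      C * (Q.len * |s - Q.time| ^ (-(3/2):ℝ)) := by
  obtain ⟨C, hC, h⟩ := mconvW_time n
  refine ⟨4 * (2 * (n + 1) + C) + 16 * C, by positivity, fun μ hμ hfin hg Q p hp s hs => ?_⟩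
  have hl := Q.len_pos
  have hs2 : 2 * Q.len ^ 2 ≤ |s - Q.time| := by
    by_contra! h
    exact hs ⟨by linarith [(abs_lt.1 h).1], by linarith [(abs_lt.1 h).2]⟩
  have hpt := hp.2
  have hd : 0 < |s - Q.time| := lt_of_lt_of_le (by positivity) hs2
  have hlip := fun t => mconvW_lip hμ hfin hg p.1 Q.base.1 t
  have hx := Q.norm_sub_le hp
  have e1 : |s - Q.time| ^ (-(3/2):ℝ) = (√|s - Q.time| ^ 3)⁻¹ := by
    rw [Real.rpow_neg (abs_nonneg _), rpow32]
  rw [rpow32, rpow32, e1]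
  have eb : Q.base.2 = Q.time := rfl
  rw [eb]
  apply real_far (Real.sqrt_nonneg _) (Real.sqrt_pos.2 hd) hl (by positivity) hC.le
  · rw [Real.sq_sqrt (abs_nonneg _)]; exact hs2
  · rw [Real.sq_sqrt (abs_nonneg _), Real.sq_sqrt (abs_nonneg _)]
    refine (abs_abs_sub_abs_le _ _).trans ?_
    rw [abs_le]; constructor <;> linarith [hpt.1, hpt.2]
  · have a1 := hlip s
    have a2 := hlip p.2
    have a3 := h μ hμ hfin Q.base.1 p.2 Q.time
    have a4 : √|p.2 - Q.time| ≤ Q.len := by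
      apply Real.sqrt_le_iff.2 ⟨hl.le, ?_⟩
      rw [abs_le]; constructor <;> linarith [hpt.1, hpt.2]
    have a5 : C * √|p.2 - Q.time| ≤ C * Q.len := by gcongr
    have b1 := a1.trans hx
    have b2 := a2.trans hx
    have b3 := a3.trans a5
    have e2 : mconvW μ p = mconvW μ (p.1, p.2) := rfl
    have e3 : mconvW μ Q.base = mconvW μ (Q.base.1, Q.time) := rfl
    rw [e2, e3]
    rw [abs_le] at b1 b2 b3 ⊢
    constructor <;> linarith [b1.1, b1.2, b2.1, b2.2, b3.1, b3.2]
  · exact h μ hμ hfin Q.base.1 s Q.time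

lemma lint_tail {R : ℝ} (hR : 0 < R) :
    ∫⁻ u in Ici R, ENNReal.ofReal (|u| ^ (-(3/2):ℝ)) ≤ ENNReal.ofReal (2 * (√R)⁻¹) := by
  have hi := integrableOn_Ioi_rpow_of_lt (a := -(3/2)) (by norm_num) hR
  have hv := integral_Ioi_rpow_of_lt (a := -(3/2)) (by norm_num) hR
  have e0 : ∫⁻ u in Ici R, ENNReal.ofReal (|u| ^ (-(3/2):ℝ)) = ∫⁻ u in Ioi R, ENNReal.ofReal (|u| ^ (-(3/2):ℝ)) :=
    setLIntegral_congr Ioi_ae_eq_Ici.symm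
  have e : ∫⁻ u in Ioi R, ENNReal.ofReal (|u| ^ (-(3/2):ℝ)) = ∫⁻ u in Ioi R, ENNReal.ofReal (u ^ (-(3/2):ℝ)) := by
    refine setLIntegral_congr_fun measurableSet_Ioi fun u hu => ?_
    show ENNReal.ofReal (|u| ^ (-(3/2):ℝ)) = _
    rw [abs_of_pos (hR.trans hu)]
  rw [e0, e, ← ofReal_integral_eq_lintegral_ofReal hi, hv]
  · apply le_of_eq
    congr 1
    rw [show (-(3/2) + 1 : ℝ) = -(1/2) by norm_num, Real.rpow_neg hR.le, ← Real.sqrt_eq_rpow]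
    field_simp
  · refine (ae_restrict_mem measurableSet_Ioi).mono fun u hu => ?_
    exact Real.rpow_nonneg (hR.trans hu).le _

lemma far_lint {n : ℕ} (Q : PCube n) :
    ∫⁻ s in Q.winᶜ, ENNReal.ofReal (Q.len * |s - Q.time| ^ (-(3/2):ℝ)) ≤ ENNReal.ofReal 4 := by
  have hl := Q.len_pos
  set R := 2 * Q.len ^ 2 with hR
  have hR0 : 0 < R := by positivity
  have hpre : Q.winᶜ = (fun s => s - Q.time) ⁻¹' (Iic (-R) ∪ Ici R) := by
    ext s
    simp only [PCube.win, mem_compl_iff, mem_Ioo, not_and_or, not_lt, mem_preimage, mem_union, mem_Iic, mem_Ici]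
    constructor <;> rintro (h | h)
    · exact Or.inl (by linarith)
    · exact Or.inr (by linarith)
    · exact Or.inl (by linarith)
    · exact Or.inr (by linarith)
  have hneg : ∫⁻ u in Iic (-R), ENNReal.ofReal (|u| ^ (-(3/2):ℝ)) =
      ∫⁻ u in Ici R, ENNReal.ofReal (|u| ^ (-(3/2):ℝ)) := by
    have := (Measure.measurePreserving_neg (volume : Measure ℝ)).setLIntegral_comp_preimage
      (s := Iic (-R)) measurableSet_Iic (f := fun u => ENNReal.ofReal (|u| ^ (-(3/2):ℝ))) (by fun_prop)
    rw [← this]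
    simp
  have h1 := (measurePreserving_sub_right (volume : Measure ℝ) Q.time).setLIntegral_comp_preimage
      (s := Iic (-R) ∪ Ici R) (measurableSet_Iic.union measurableSet_Ici)
      (f := fun u => ENNReal.ofReal (|u| ^ (-(3/2):ℝ))) (by fun_prop)
  simp_rw [ENNReal.ofReal_mul hl.le]
  rw [lintegral_const_mul _ (by fun_prop), hpre, h1]
  calc _ ≤ ENNReal.ofReal Q.len * ((∫⁻ u in Iic (-R), ENNReal.ofReal (|u| ^ (-(3/2):ℝ))) +
        ∫⁻ u in Ici R, ENNReal.ofReal (|u| ^ (-(3/2):ℝ))) := mul_le_mul_right (lintegral_union_le _ _ _) _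
    _ ≤ ENNReal.ofReal Q.len * (ENNReal.ofReal (2 * (√R)⁻¹) + ENNReal.ofReal (2 * (√R)⁻¹)) := by
        rw [hneg]
        exact mul_le_mul_right (add_le_add (lint_tail hR0) (lint_tail hR0)) _
    _ ≤ _ := by
        rw [← ENNReal.ofReal_add (by positivity) (by positivity), ← ENNReal.ofReal_mul hl.le]
        apply ENNReal.ofReal_le_ofReal
        have h2 : Q.len ≤ √R := by
          apply Real.le_sqrt_of_sq_le
          nlinarith [sq_nonneg Q.len]
        have h3 : Q.len * (√R)⁻¹ ≤ 1 := by
          rw [← div_eq_mul_inv]; exact (div_le_one (lt_of_lt_of_le hl h2)).2 h2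
        linarith


lemma enorm_w {n : ℕ} (f : Pt n → ℝ) (p : Pt n) (s : ℝ) :
    ‖(f (p.1, s) - f p) / |s - p.2| ^ (3/2:ℝ)‖ₑ =
      ‖f (p.1, s) - f p‖ₑ * ENNReal.ofReal (|s - p.2| ^ (-(3/2):ℝ)) := by
  rw [div_eq_mul_inv, enorm_mul, ← Real.rpow_neg (abs_nonneg _),
    Real.enorm_of_nonneg (r := |s - p.2| ^ (-(3/2):ℝ)) (by positivity)]

lemma measurable_w {n : ℕ} {f : Pt n → ℝ} (hf : Measurable f) :
    Measurable fun z : Pt n × ℝ => (f (z.1.1, z.2) - f z.1) / |z.2 - z.1.2| ^ (3/2:ℝ) := by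
  fun_prop

lemma measurable_w1 {n : ℕ} {f : Pt n → ℝ} (hf : Measurable f) (p : Pt n) :
    Measurable fun s : ℝ => (f (p.1, s) - f p) / |s - p.2| ^ (3/2:ℝ) := by
  fun_prop

lemma measurable_halfT {n : ℕ} {f : Pt n → ℝ} (hf : Measurable f) : Measurable (halfT f) :=
  (StronglyMeasurable.integral_prod_right' (measurable_w hf).stronglyMeasurable).measurable

lemma halfT_osc {n : ℕ} {f : Pt n → ℝ} (hf : Measurable f) (Q : PCube n) {K : ℝ} (hK : 0 ≤ K)
    (h : ∀ p ∈ Q.toSet, ∀ s ∉ Q.win,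
      |(f (p.1, s) - f p) / |s - p.2| ^ (3/2:ℝ) -
      (f (Q.base.1, s) - f Q.base) / |s - Q.base.2| ^ (3/2:ℝ)| ≤
      K * (Q.len * |s - Q.time| ^ (-(3/2):ℝ))) :
    ∃ c : ℝ, ∀ p ∈ Q.toSet, ‖halfT f p - c‖ₑ ≤ nearN f Q p + ENNReal.ofReal (4 * K) := by
  set w : Pt n → ℝ → ℝ := fun p s => (f (p.1, s) - f p) / |s - p.2| ^ (3/2:ℝ) with hw
  have hwm : ∀ p, Measurable (w p) := fun p => measurable_w1 hf p
  have hwin : MeasurableSet Q.win := measurableSet_Ioo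
  have hdiff : ∀ p ∈ Q.toSet, ∫⁻ s in Q.winᶜ, ‖w p s - w Q.base s‖ₑ ≤ ENNReal.ofReal (4 * K) := by
    intro p hp
    calc _ ≤ ∫⁻ s in Q.winᶜ, ENNReal.ofReal K * ENNReal.ofReal (Q.len * |s - Q.time| ^ (-(3/2):ℝ)) := by
          refine setLIntegral_mono' hwin.compl fun s hs => ?_
          rw [← ENNReal.ofReal_mul hK, Real.enorm_eq_ofReal_abs]
          exact ENNReal.ofReal_le_ofReal (h p hp s hs)
      _ ≤ _ := by
          rw [lintegral_const_mul _ (by fun_prop), mul_comm 4 K, ENNReal.ofReal_mul hK]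
          exact mul_le_mul_right (far_lint Q) _
  have hdi : ∀ p ∈ Q.toSet, IntegrableOn (fun s => w p s - w Q.base s) Q.winᶜ := fun p hp =>
    ⟨((hwm p).sub (hwm _)).aestronglyMeasurable, (hdiff p hp).trans_lt ENNReal.ofReal_lt_top⟩
  by_cases hb : IntegrableOn (w Q.base) Q.winᶜ
  · refine ⟨∫ s in Q.winᶜ, w Q.base s, fun p hp => ?_⟩
    by_cases hN : nearN f Q p = ⊤
    · simp [hN]
    have hnear : ∫⁻ s in Q.win, ‖w p s‖ₑ = nearN f Q p := by
      unfold nearN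
      exact lintegral_congr fun s => enorm_w f p s
    have i1 : IntegrableOn (w p) Q.win :=
      ⟨(hwm p).aestronglyMeasurable, by
        show ∫⁻ s in Q.win, ‖w p s‖ₑ < ⊤
        rw [hnear]; exact lt_top_iff_ne_top.2 hN⟩
    have i2 : IntegrableOn (w p) Q.winᶜ := by
      have := (hdi p hp).add hb
      refine this.congr (.of_forall fun s => ?_)
      simp
    have i3 : Integrable (w p) := by
      rw [← integrableOn_univ, ← union_compl_self Q.win]
      exact i1.union i2
    have e : halfT f p - ∫ s in Q.winᶜ, w Q.base s =
        (∫ s in Q.win, w p s) + ∫ s in Q.winᶜ, (w p s - w Q.base s) := by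
      rw [integral_sub i2 hb]
      have := integral_add_compl hwin i3
      have e2 : halfT f p = ∫ s, w p s := rfl
      rw [e2, ← this]; ring
    rw [e]
    refine (enorm_add_le _ _).trans (add_le_add ?_ ?_)
    · rw [← hnear]; exact enorm_integral_le_lintegral_enorm _
    · exact (enorm_integral_le_lintegral_enorm _).trans (hdiff p hp)
  · refine ⟨0, fun p hp => ?_⟩
    have : halfT f p = 0 := by
      apply integral_undef
      intro hi
      apply hb
      have h1 : IntegrableOn (w p) Q.winᶜ := hi.integrableOn
      have := h1.sub (hdi p hp)
      refine this.congr (.of_forall fun s => ?_)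
      simp
    simp [this]

lemma bmo_of {n : ℕ} {h : Pt n → ℝ} (hm : Measurable h) (Q : PCube n) (c K : ℝ) (hK : 0 ≤ K)
    (hb : ∫⁻ p in Q.toSet, ‖h p - c‖ₑ ≤ ENNReal.ofReal (K * Q.len ^ (n+2))) :
    ⨍ p in Q.toSet, |h p - ⨍ q in Q.toSet, h q| ≤ 2 * K := by
  have hl := Q.len_pos
  have hV : volume.real Q.toSet = Q.len ^ (n+2) := by
    rw [measureReal_def, Q.volume_eq, ENNReal.toReal_ofReal (by positivity)]
  have hVfin : volume Q.toSet ≠ ⊤ := by rw [Q.volume_eq]; exact ENNReal.ofReal_ne_top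
  have hfin : IsFiniteMeasure (volume.restrict Q.toSet) := isFiniteMeasure_restrict.2 hVfin
  have i1 : IntegrableOn (fun p => h p - c) Q.toSet :=
    ⟨(hm.sub_const c).aestronglyMeasurable, hb.trans_lt ENNReal.ofReal_lt_top⟩
  have ic : ∀ a : ℝ, IntegrableOn (fun _ : Pt n => a) Q.toSet := fun a => integrable_const a
  have i0 : IntegrableOn h Q.toSet := by
    refine (i1.add (ic c)).congr (.of_forall fun s => ?_)
    simp
  have hI : ∫ p in Q.toSet, |h p - c| ≤ K * Q.len ^ (n+2) := by
    have := integral_norm_eq_lintegral_enorm i1.aestronglyMeasurable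
    simp only [Real.norm_eq_abs] at this
    rw [this]
    exact ENNReal.toReal_le_of_le_ofReal (by positivity) hb
  set V := Q.len ^ (n+2) with hVd
  have hV0 : 0 < V := by positivity
  set A := ⨍ q in Q.toSet, h q with hA
  have hAe : A = V⁻¹ * ∫ q in Q.toSet, h q := by
    rw [hA, setAverage_eq, hV]; rfl
  have hcint : ∀ a : ℝ, ∫ p in Q.toSet, a = V * a := fun a => by
    rw [setIntegral_const, hV]; rfl
  have hAc : |c - A| ≤ K := by
    have e : c - A = - (V⁻¹ * ∫ q in Q.toSet, (h q - c)) := by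
      rw [integral_sub i0 (ic c), hcint, hAe]; field_simp; ring
    rw [e, abs_neg, abs_mul, abs_of_pos (inv_pos.2 hV0)]
    calc _ ≤ V⁻¹ * (K * V) := by
          gcongr
          exact abs_integral_le_integral_abs.trans hI
      _ = K := by field_simp
  rw [setAverage_eq, hV, smul_eq_mul]
  calc _ ≤ V⁻¹ * ∫ p in Q.toSet, (|h p - c| + |c - A|) := by
        refine mul_le_mul_of_nonneg_left ?_ (inv_pos.2 hV0).le
        refine integral_mono (i0.sub (ic A)).abs (i1.abs.add (ic _)) fun p => ?_
        exact abs_sub_le _ _ _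
    _ = V⁻¹ * ((∫ p in Q.toSet, |h p - c|) + V * |c - A|) := by
        rw [integral_add i1.abs (ic _), hcint]
    _ ≤ V⁻¹ * (K * V + V * K) := by gcongr
    _ = _ := by field_simp; ring


/-- Lemma 4.1: for a positive measure with parabolic growth and bounded
`∇ₓ W * μ`, the half time derivative of `W*μ` is in parabolic BMO. -/
theorem halfT_mconvW_bmo (n : ℕ) (hn : 1 ≤ n) :
    ∃ C : ℝ, 0 < C ∧ ∀ μ : Measure (Pt n), PGrowth μ →
      (∀ p, ‖mconvGradW μ p‖ ≤ 1) →
      ParabBMOLe (halfT (mconvW μ)) C := by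
  obtain ⟨C1, hC1, h1⟩ := nearN_bound n
  obtain ⟨C2, hC2, h2⟩ := far_pt n
  refine ⟨2 * (C1 + 4 * C2), by positivity, fun μ hμ hg Q => ?_⟩
  by_cases hfin : ∀ p, eW μ p < ⊤
  · have hm : Measurable (mconvW μ) := (mconvW_continuous hμ hfin).measurable
    obtain ⟨c, hc⟩ := halfT_osc hm Q hC2.le (h2 μ hμ hfin hg Q)
    have hl := Q.len_pos
    refine bmo_of (measurable_halfT hm) Q c _ (by positivity) ?_
    calc _ ≤ ∫⁻ p in Q.toSet, (nearN (mconvW μ) Q p + ENNReal.ofReal (4 * C2)) :=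
          setLIntegral_mono' Q.measurableSet hc
      _ = (∫⁻ p in Q.toSet, nearN (mconvW μ) Q p) + ENNReal.ofReal (4 * C2) * volume Q.toSet := by
          rw [lintegral_add_right _ measurable_const, setLIntegral_const]
      _ ≤ ENNReal.ofReal (C1 * Q.len ^ (n + 2)) + ENNReal.ofReal (4 * C2) * ENNReal.ofReal (Q.len ^ (n + 2)) := by
          rw [Q.volume_eq]
          exact add_le_add (h1 μ hμ hfin Q) le_rfl
      _ = _ := by
          rw [← ENNReal.ofReal_mul (by positivity), ← ENNReal.ofReal_add (by positivity) (by positivity)]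
          congr 1; ring
  · push Not at hfin
    obtain ⟨p, hp⟩ := hfin
    have hz : ∀ q, mconvW μ q = 0 := by
      intro q
      rw [mconvW_eq_eW]
      have : eW μ q = ⊤ := by
        by_contra h
        exact absurd (eW_finite_iff hμ q p (lt_top_iff_ne_top.2 h)) (not_lt.2 hp)
      simp [this]
    have hh : ∀ q, halfT (mconvW μ) q = 0 := by
      intro q
      simp [halfT, hz]
    simp only [hh]
    simp
    positivity
end
end

section
/- Let n ≥ 1 and s > n + 1. Let E ⊂ ℝ^{n+1} be a compact set carrying a nonzero finite positive Borel measure μ with μ(B_p(x̄,r)) ≤ r^s for all x̄ ∈ ℝ^{n+1} and r > 0. Then γ_{Θ,+}(E) > 0; equivalently, there exists a nonzero positive Borel measure ν supported on E with ‖∇_x W * ν‖_∞ ≤ 1 and ‖∂_t^{1/2}(W * ν)‖_{*,p} ≤ 1. -/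
open MeasureTheory Real Set

noncomputable section

lemma exp_aux (q : ℝ) : ∃ C : ℝ, 0 < C ∧ ∀ z : ℝ, 0 ≤ z → (1 + z) ^ q ≤ C * Real.exp (z / 8) := by
  obtain ⟨N, hN⟩ := exists_nat_ge (max q 1)
  have hN1 : (1:ℝ) ≤ N := le_trans (le_max_right _ _) hN
  have hNq : q ≤ N := le_trans (le_max_left _ _) hN
  refine ⟨(8 * N) ^ N, by positivity, fun z hz => ?_⟩
  have h1 : (1 + z) ^ q ≤ (1 + z) ^ N := by
    rw [← Real.rpow_natCast]
    exact Real.rpow_le_rpow_of_exponent_le (by linarith) hNq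
  have h2 : 1 + z ≤ 8 * N * Real.exp (z / (8 * N)) := by
    have h3 := Real.add_one_le_exp (z / (8 * N))
    have h4 : 8 * N * (z / (8 * N) + 1) = z + 8 * N := by field_simp
    have h5 := mul_le_mul_of_nonneg_left h3 (by positivity : (0:ℝ) ≤ 8 * N)
    linarith
  calc (1 + z) ^ q ≤ (1 + z) ^ N := h1
    _ ≤ (8 * N * Real.exp (z / (8 * N))) ^ N := by gcongr
    _ = (8 * N) ^ N * Real.exp (z / 8) := by
        rw [mul_pow, ← Real.exp_nat_mul]
        congr 2
        field_simp

lemma key_aux (q : ℝ) (hq : 0 ≤ q) : ∃ C : ℝ, 0 < C ∧ ∀ r τ : ℝ, 0 < τ →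
    τ ^ (-q) * Real.exp (-r ^ 2 / (8 * τ)) ≤ C * (max r (Real.sqrt τ)) ^ (-(2 * q)) := by
  obtain ⟨C, hC, h⟩ := exp_aux q
  refine ⟨C, hC, fun r τ hτ => ?_⟩
  have hs : 0 < Real.sqrt τ := Real.sqrt_pos.2 hτ
  set ρ := max r (Real.sqrt τ) with hρ
  have hρ0 : 0 < ρ := lt_of_lt_of_le hs (le_max_right _ _)
  have hz := h (r ^ 2 / τ) (by positivity)
  have h1 : ρ ^ 2 ≤ τ * (1 + r ^ 2 / τ) := by
    have h2 : τ * (1 + r ^ 2 / τ) = τ + r ^ 2 := by field_simp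
    rw [h2]
    have h3 := Real.sq_sqrt hτ.le
    rcases max_cases r (Real.sqrt τ) with ⟨h4, _⟩ | ⟨h4, _⟩
    · rw [hρ, h4]; linarith
    · rw [hρ, h4, h3]; nlinarith [sq_nonneg r]
  have h2 : ρ ^ (2 * q) ≤ τ ^ q * (C * Real.exp (r ^ 2 / τ / 8)) := by
    rw [Real.rpow_mul hρ0.le, Real.rpow_two]
    calc (ρ ^ 2) ^ q ≤ (τ * (1 + r ^ 2 / τ)) ^ q := by gcongr
      _ = τ ^ q * (1 + r ^ 2 / τ) ^ q := Real.mul_rpow hτ.le (by positivity)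
      _ ≤ _ := by gcongr
  have e1 : Real.exp (-r ^ 2 / (8 * τ)) = (Real.exp (r ^ 2 / τ / 8))⁻¹ := by
    rw [← Real.exp_neg]; congr 1; field_simp
  rw [e1, Real.rpow_neg hτ.le, Real.rpow_neg hρ0.le, ← mul_inv, ← div_eq_mul_inv,
    le_div_iff₀ (by positivity), inv_mul_le_iff₀ (by positivity)]
  linarith

lemma pnorm_of_pos {n : ℕ} (p : Pt n) (h : 0 < p.2) : pnorm p = max ‖p.1‖ (Real.sqrt p.2) := by
  simp [pnorm, abs_of_pos h]

lemma pnorm_pos {n : ℕ} (p : Pt n) (h : 0 < p.2) : 0 < pnorm p := by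
  rw [pnorm_of_pos p h]
  exact lt_of_lt_of_le (Real.sqrt_pos.2 h) (le_max_right _ _)

lemma key {n : ℕ} (q : ℝ) (hq : 0 ≤ q) : ∃ C : ℝ, 0 < C ∧ ∀ p : Pt n, 0 < p.2 →
    p.2 ^ (-q) * Real.exp (-‖p.1‖ ^ 2 / (8 * p.2)) ≤ C * pnorm p ^ (-(2 * q)) := by
  obtain ⟨C, hC, h⟩ := key_aux q hq
  exact ⟨C, hC, fun p hp => by rw [pnorm_of_pos p hp]; exact h _ _ hp⟩

lemma fourpi (n : ℕ) (τ : ℝ) (h : 0 < τ) : (4 * π * τ) ^ (-(n : ℝ) / 2) ≤ τ ^ (-(n : ℝ) / 2) := by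
  apply Real.rpow_le_rpow_of_nonpos h
  · nlinarith [Real.pi_gt_three]
  · have : (0:ℝ) ≤ n := by positivity
    linarith

lemma exp48 (r τ : ℝ) (h : 0 < τ) : Real.exp (-r ^ 2 / (4 * τ)) ≤ Real.exp (-r ^ 2 / (8 * τ)) := by
  apply Real.exp_le_exp.2
  rw [div_le_div_iff₀ (by positivity) (by positivity)]
  nlinarith [mul_nonneg (sq_nonneg r) h.le]

/-- `W(p) ≤ C t^k |p|^{-n-2k}`. -/
lemma heatW_le {n : ℕ} (k : ℝ) (hk : 0 ≤ k) : ∃ C : ℝ, 0 < C ∧ ∀ p : Pt n, 0 < p.2 →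
    heatW p ≤ C * (p.2 ^ k * pnorm p ^ (-((n : ℝ) + 2 * k))) := by
  obtain ⟨C, hC, h⟩ := key (n := n) ((n : ℝ) / 2 + k) (by positivity)
  refine ⟨C, hC, fun p hp => ?_⟩
  have h1 := h p hp
  have e1 : p.2 ^ (-(n : ℝ) / 2) = p.2 ^ k * p.2 ^ (-((n : ℝ) / 2 + k)) := by
    rw [← Real.rpow_add hp]; congr 1; ring
  have e2 : -((n : ℝ) + 2 * k) = -(2 * ((n : ℝ) / 2 + k)) := by ring
  unfold heatW
  rw [if_pos hp, e2]
  calc _ ≤ p.2 ^ (-(n : ℝ) / 2) * Real.exp (-‖p.1‖ ^ 2 / (8 * p.2)) := by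
        exact mul_le_mul (fourpi n _ hp) (exp48 _ _ hp) (by positivity) (by positivity)
    _ = p.2 ^ k * (p.2 ^ (-((n : ℝ) / 2 + k)) * Real.exp (-‖p.1‖ ^ 2 / (8 * p.2))) := by
        rw [e1]; ring
    _ ≤ p.2 ^ k * (C * pnorm p ^ (-(2 * ((n : ℝ) / 2 + k)))) := by gcongr
    _ = _ := by ring

lemma gradW_le {n : ℕ} : ∃ C : ℝ, 0 < C ∧ ∀ p : Pt n,
    ‖gradW p‖ ≤ C * pnorm p ^ (-((n : ℝ) + 1)) := by
  obtain ⟨C, hC, h⟩ := key (n := n) ((n : ℝ) / 2 + 1) (by positivity)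
  refine ⟨C, hC, fun p => ?_⟩
  unfold gradW
  split_ifs with hp
  · have h1 := h p hp
    have hρ := pnorm_pos p hp
    have := Real.pi_pos
    have hx : ‖p.1‖ ≤ pnorm p := le_max_left _ _
    have e1 : 1 / (2 * p.2) * p.2 ^ (-(n : ℝ) / 2) ≤ p.2 ^ (-((n : ℝ) / 2 + 1)) := by
      have : p.2 ^ (-((n : ℝ) / 2 + 1)) = p.2⁻¹ * p.2 ^ (-(n : ℝ) / 2) := by
        rw [← Real.rpow_neg_one, ← Real.rpow_add hp]; congr 1; ring
      rw [this]
      gcongr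
      rw [one_div]
      apply inv_anti₀ hp; linarith
    have e2 : pnorm p ^ (-((n : ℝ) + 1)) = pnorm p ^ (-(2 * ((n : ℝ) / 2 + 1))) * pnorm p := by
      rw [← Real.rpow_add_one hρ.ne']; congr 1; ring
    rw [norm_smul, Real.norm_eq_abs, abs_mul, abs_mul, abs_neg, abs_of_pos (by positivity),
      abs_of_pos (by positivity), abs_of_pos (by positivity), e2]
    calc _ ≤ 1 / (2 * p.2) * p.2 ^ (-(n : ℝ) / 2) * Real.exp (-‖p.1‖ ^ 2 / (8 * p.2)) * pnorm p := by
          have g1 := fourpi n _ hp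
          have g2 := exp48 ‖p.1‖ _ hp
          refine mul_le_mul (mul_le_mul (mul_le_mul_of_nonneg_left g1 ?_) g2 ?_ ?_) hx ?_ ?_ <;>
            positivity
      _ ≤ p.2 ^ (-((n : ℝ) / 2 + 1)) * Real.exp (-‖p.1‖ ^ 2 / (8 * p.2)) * pnorm p := by gcongr
      _ ≤ C * pnorm p ^ (-(2 * ((n : ℝ) / 2 + 1))) * pnorm p := by gcongr
      _ = _ := by ring
  · rw [norm_zero]
    have := pnorm_nonneg p
    positivity

/-- Time Lipschitz bound for positive times. -/
lemma heatW_lip {n : ℕ} : ∃ C : ℝ, 0 < C ∧ ∀ (x : Spc n) (t t' : ℝ), 0 < t' → t' < t →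
    |heatW (x, t) - heatW (x, t')| ≤ C * ((t - t') * pnorm (x, t') ^ (-((n : ℝ) + 2))) := by
  obtain ⟨C, hC, h⟩ := key (n := n) ((n : ℝ) / 2 + 1) (by positivity)
  refine ⟨((n : ℝ) / 2 + 2) * C, by positivity, fun x t t' ht' htt => ?_⟩
  have hpi := Real.pi_pos
  set K := ((n : ℝ) / 2 + 2) * C * pnorm (x, t') ^ (-((n : ℝ) + 2)) with hK
  let f : ℝ → ℝ := fun τ => (4 * π * τ) ^ (-(n : ℝ) / 2) * Real.exp (-‖x‖ ^ 2 / (4 * τ))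
  have hf : ∀ τ, 0 < τ → heatW (x, τ) = f τ := fun τ hτ => by simp [heatW, hτ, f]
  have hder : ∀ τ, 0 < τ → HasDerivAt f
      (f τ * (-(n : ℝ) / 2 / τ + ‖x‖ ^ 2 / (4 * τ ^ 2))) τ := by
    intro τ hτ
    have d1 : HasDerivAt (fun τ : ℝ => 4 * π * τ) (4 * π) τ := by
      simpa using (hasDerivAt_id τ).const_mul (4 * π)
    have d2 := d1.rpow_const (p := -(n : ℝ) / 2) (Or.inl (by positivity))
    have d3 : HasDerivAt (fun τ : ℝ => -‖x‖ ^ 2 / (4 * τ)) (‖x‖ ^ 2 / (4 * τ ^ 2)) τ := by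
      have d4 := ((hasDerivAt_id τ).inv hτ.ne').const_mul (-‖x‖ ^ 2 / 4)
      have e : (fun τ : ℝ => -‖x‖ ^ 2 / (4 * τ)) = fun τ => -‖x‖ ^ 2 / 4 * (id⁻¹ : ℝ → ℝ) τ := by
        funext y; simp only [Pi.inv_apply, id]; rw [← div_div, div_eq_mul_inv (-‖x‖ ^ 2 / 4)]
      rw [e]
      refine d4.congr_deriv ?_
      show -‖x‖ ^ 2 / 4 * (-1 / τ ^ 2) = _
      field_simp
    have d5 := d2.mul d3.exp
    refine d5.congr_deriv ?_
    have e3 : (4 * π * τ) ^ (-(n : ℝ) / 2 - 1) = (4 * π * τ) ^ (-(n : ℝ) / 2) / (4 * π * τ) :=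
      Real.rpow_sub_one (by positivity) _
    rw [e3]
    simp only [f]
    field_simp
  have hbd : ∀ τ ∈ Set.Icc t' t, ‖f τ * (-(n : ℝ) / 2 / τ + ‖x‖ ^ 2 / (4 * τ ^ 2))‖ ≤ K := by
    intro τ hτ
    have hτ0 : 0 < τ := lt_of_lt_of_le ht' hτ.1
    have h1 := h (x, τ) hτ0
    have hρ' := pnorm_pos ((x, t') : Pt n) ht'
    have hmono : pnorm ((x, t') : Pt n) ≤ pnorm ((x, τ) : Pt n) := by
      rw [pnorm_of_pos _ (by exact ht'), pnorm_of_pos _ (by exact hτ0)]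
      exact max_le_max le_rfl (Real.sqrt_le_sqrt hτ.1)
    have h2 : pnorm ((x, τ) : Pt n) ^ (-(2 * ((n : ℝ) / 2 + 1))) ≤
        pnorm ((x, t') : Pt n) ^ (-((n : ℝ) + 2)) := by
      have e2 : -((n : ℝ) + 2) = -(2 * ((n : ℝ) / 2 + 1)) := by ring
      rw [e2]
      apply Real.rpow_le_rpow_of_nonpos hρ' hmono
      have : (0:ℝ) ≤ n := by positivity
      linarith
    have h3 : |-(n : ℝ) / 2 / τ + ‖x‖ ^ 2 / (4 * τ ^ 2)| ≤
        τ⁻¹ * (((n : ℝ) / 2 + 2) * Real.exp (‖x‖ ^ 2 / (8 * τ))) := by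
      have e0 := Real.add_one_le_exp (‖x‖ ^ 2 / (8 * τ))
      have e4 : -(n : ℝ) / 2 / τ + ‖x‖ ^ 2 / (4 * τ ^ 2) =
        τ⁻¹ * (-((n : ℝ) / 2) + 2 * (‖x‖ ^ 2 / (8 * τ))) := by field_simp; ring
      rw [e4, abs_mul, abs_of_pos (inv_pos.2 hτ0)]
      gcongr
      have hz : 0 ≤ ‖x‖ ^ 2 / (8 * τ) := by positivity
      have hn0 : (0:ℝ) ≤ n := by positivity
      rw [abs_le]
      constructor <;> nlinarith
    have e5 : τ ^ (-((n : ℝ) / 2 + 1)) = τ⁻¹ * τ ^ (-(n : ℝ) / 2) := by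
      rw [← Real.rpow_neg_one, ← Real.rpow_add hτ0]; congr 1; ring
    have e6 : Real.exp (-‖x‖ ^ 2 / (4 * τ)) * Real.exp (‖x‖ ^ 2 / (8 * τ)) =
        Real.exp (-‖x‖ ^ 2 / (8 * τ)) := by
      rw [← Real.exp_add]; congr 1; field_simp; ring
    have hfn : 0 ≤ f τ := by simp only [f]; positivity
    rw [Real.norm_eq_abs, abs_mul, abs_of_nonneg hfn]
    calc _ ≤ f τ * (τ⁻¹ * (((n : ℝ) / 2 + 2) * Real.exp (‖x‖ ^ 2 / (8 * τ)))) := by gcongr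
      _ = ((n : ℝ) / 2 + 2) * ((4 * π * τ) ^ (-(n : ℝ) / 2) * τ⁻¹ *
          Real.exp (-‖x‖ ^ 2 / (8 * τ))) := by rw [← e6]; simp only [f]; ring
      _ ≤ ((n : ℝ) / 2 + 2) * (τ ^ (-(n : ℝ) / 2) * τ⁻¹ *
          Real.exp (-‖x‖ ^ 2 / (8 * τ))) := by
          have g1 := fourpi n _ hτ0
          gcongr ?_ * (?_ * _ * _)
      _ = ((n : ℝ) / 2 + 2) * (τ ^ (-((n : ℝ) / 2 + 1)) * Real.exp (-‖x‖ ^ 2 / (8 * τ))) := by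
          rw [e5]; ring
      _ ≤ ((n : ℝ) / 2 + 2) * (C * pnorm ((x, t') : Pt n) ^ (-((n : ℝ) + 2))) := by
          exact mul_le_mul_of_nonneg_left (h1.trans (by gcongr)) (by positivity)
      _ = K := by rw [hK]; ring
  have hm := (convex_Icc t' t).norm_image_sub_le_of_norm_hasDerivWithin_le (f := f)
    (fun τ hτ => (hder τ (lt_of_lt_of_le ht' hτ.1)).hasDerivWithinAt) hbd
    (left_mem_Icc.2 htt.le) (right_mem_Icc.2 htt.le)
  rw [hf _ ht', hf _ (ht'.trans htt)]
  rw [Real.norm_eq_abs, Real.norm_eq_abs, abs_of_pos (sub_pos.2 htt)] at hm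
  refine hm.trans (le_of_eq ?_)
  rw [hK]; ring

/-- Time Hölder bound, ordered times. -/
lemma heatW_hol_aux {n : ℕ} (α : ℝ) (h0 : 0 < α) (h1 : α < 1) : ∃ C : ℝ, 0 < C ∧
    ∀ (x : Spc n) (t t' : ℝ), t' < t →
    |heatW (x, t) - heatW (x, t')| ≤ C * ((t - t') ^ α *
      (pnorm (x, t) ^ (-((n : ℝ) + 2 * α)) + pnorm (x, t') ^ (-((n : ℝ) + 2 * α)))) := by
  obtain ⟨A, hA, hA'⟩ := heatW_le (n := n) 0 le_rfl
  obtain ⟨B, hB, hB'⟩ := heatW_le (n := n) α h0.le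
  obtain ⟨D, hD, hD'⟩ := heatW_lip (n := n)
  refine ⟨B + A ^ (1 - α) * D ^ α, by positivity, fun x t t' htt => ?_⟩
  have hd : 0 < t - t' := sub_pos.2 htt
  have n1 := pnorm_nonneg ((x, t) : Pt n)
  have n2 := pnorm_nonneg ((x, t') : Pt n)
  rcases le_or_gt t 0 with ht | ht
  · have e1 : heatW ((x, t) : Pt n) = 0 := by simp [heatW, not_lt.2 ht]
    have e2 : heatW ((x, t') : Pt n) = 0 := by simp [heatW, not_lt.2 (htt.le.trans ht)]
    rw [e1, e2, sub_zero, abs_zero]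
    positivity
  rcases le_or_gt t' 0 with ht' | ht'
  · have e2 : heatW ((x, t') : Pt n) = 0 := by simp [heatW, not_lt.2 ht']
    rw [e2, sub_zero, abs_of_nonneg (heatW_nonneg _)]
    calc _ ≤ B * (t ^ α * pnorm (x, t) ^ (-((n : ℝ) + 2 * α))) := hB' (x, t) ht
      _ ≤ _ := by
        gcongr
        · linarith [show 0 ≤ A ^ (1 - α) * D ^ α by positivity]
        · linarith
        · linarith [show 0 ≤ pnorm ((x, t') : Pt n) ^ (-((n : ℝ) + 2 * α)) by positivity]
  · have hρ' := pnorm_pos ((x, t') : Pt n) ht'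
    set ρ := pnorm ((x, t') : Pt n) with hρ
    have hmono : ρ ≤ pnorm ((x, t) : Pt n) := by
      rw [hρ, pnorm_of_pos _ (by exact ht'), pnorm_of_pos _ (by exact ht)]
      exact max_le_max le_rfl (Real.sqrt_le_sqrt htt.le)
    have a1 : |heatW ((x, t) : Pt n) - heatW ((x, t') : Pt n)| ≤ A * ρ ^ (-(n : ℝ)) := by
      have b1 := hA' (x, t) ht
      have b2 := hA' (x, t') ht'
      simp only [Real.rpow_zero, one_mul, mul_zero, add_zero] at b1 b2
      have b3 : pnorm ((x, t) : Pt n) ^ (-(n : ℝ)) ≤ ρ ^ (-(n : ℝ)) :=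
        Real.rpow_le_rpow_of_nonpos hρ' hmono (by simp)
      have b4 := mul_le_mul_of_nonneg_left b3 hA.le
      exact abs_sub_le_of_nonneg_of_le (heatW_nonneg _) (b1.trans b4) (heatW_nonneg _) b2
    have a2 := hD' x t t' ht' htt
    set Y := |heatW ((x, t) : Pt n) - heatW ((x, t') : Pt n)| with hY
    have hY0 : 0 ≤ Y := abs_nonneg _
    have e1 : Y = Y ^ (1 - α) * Y ^ α := by
      rw [← Real.rpow_add_of_nonneg hY0 (by linarith) h0.le]; simp
    have e2 : (A * ρ ^ (-(n : ℝ))) ^ (1 - α) * (D * ((t - t') * ρ ^ (-((n : ℝ) + 2)))) ^ α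
        = A ^ (1 - α) * D ^ α * ((t - t') ^ α * ρ ^ (-((n : ℝ) + 2 * α))) := by
      rw [Real.mul_rpow hA.le (by positivity), Real.mul_rpow hD.le (by positivity),
        Real.mul_rpow hd.le (by positivity), ← Real.rpow_mul hρ'.le, ← Real.rpow_mul hρ'.le]
      have e3 : -((n : ℝ) + 2 * α) = -(n : ℝ) * (1 - α) + -((n : ℝ) + 2) * α := by ring
      rw [e3, Real.rpow_add hρ']; ring
    calc Y = Y ^ (1 - α) * Y ^ α := e1
      _ ≤ (A * ρ ^ (-(n : ℝ))) ^ (1 - α) * (D * ((t - t') * ρ ^ (-((n : ℝ) + 2)))) ^ α := by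
        gcongr
      _ = A ^ (1 - α) * D ^ α * ((t - t') ^ α * ρ ^ (-((n : ℝ) + 2 * α))) := e2
      _ ≤ _ := by
        gcongr
        · linarith
        · linarith [show 0 ≤ pnorm ((x, t) : Pt n) ^ (-((n : ℝ) + 2 * α)) by positivity]

lemma heatW_hol {n : ℕ} (α : ℝ) (h0 : 0 < α) (h1 : α < 1) : ∃ C : ℝ, 0 < C ∧
    ∀ (x : Spc n) (t t' : ℝ),
    |heatW (x, t) - heatW (x, t')| ≤ C * (|t - t'| ^ α *
      (pnorm (x, t) ^ (-((n : ℝ) + 2 * α)) + pnorm (x, t') ^ (-((n : ℝ) + 2 * α)))) := by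
  obtain ⟨C, hC, h⟩ := heatW_hol_aux (n := n) α h0 h1
  refine ⟨C, hC, fun x t t' => ?_⟩
  rcases lt_trichotomy t' t with ht | ht | ht
  · rw [abs_of_pos (sub_pos.2 ht)]; exact h x t t' ht
  · subst ht
    simp [Real.zero_rpow h0.ne']
  · rw [abs_sub_comm, abs_sub_comm t t', abs_of_pos (sub_pos.2 ht), add_comm (pnorm (x, t) ^ _)]
    exact h x t' t ht

lemma pnorm_measurable {n : ℕ} : Measurable (fun p : Pt n => pnorm p) := by
  unfold pnorm
  fun_prop

lemma heatW_measurable {n : ℕ} : Measurable (fun p : Pt n => heatW p) := by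
  unfold heatW
  refine Measurable.ite (measurableSet_lt measurable_const measurable_snd) ?_ measurable_const
  fun_prop

lemma potential_bound {n : ℕ} (s : ℝ) (μ : Measure (Pt n)) [IsFiniteMeasure μ]
    (hgrowth : ∀ (c : Pt n) (r : ℝ), 0 < r → μ (pball c r) ≤ ENNReal.ofReal (r ^ s))
    (β : ℝ) (hβ : 0 ≤ β) (hβs : β < s) :
    ∃ M : ℝ, 0 ≤ M ∧ ∀ p : Pt n,
      ∫⁻ y, ENNReal.ofReal (pnorm (p - y) ^ (-β)) ∂μ ≤ ENNReal.ofReal M := by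
  let T : ENNReal := μ univ + 1 * μ univ +
    ∑' k : ℕ, ENNReal.ofReal ((2:ℝ) ^ β * (2:ℝ) ^ s * ((2:ℝ) ^ (β - s)) ^ k)
  have hT : T ≠ ⊤ := by
    have hsum : Summable fun k : ℕ => (2:ℝ) ^ β * (2:ℝ) ^ s * ((2:ℝ) ^ (β - s)) ^ k := by
      apply Summable.mul_left
      apply summable_geometric_of_lt_one (by positivity)
      exact Real.rpow_lt_one_of_one_lt_of_neg (by norm_num) (by linarith)
    simp only [T, one_mul]
    refine ENNReal.add_ne_top.2 ⟨ENNReal.add_ne_top.2 ⟨measure_ne_top _ _, measure_ne_top _ _⟩, ?_⟩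
    exact hsum.tsum_ofReal_ne_top
  refine ⟨T.toReal, ENNReal.toReal_nonneg, fun p => ?_⟩
  rw [ENNReal.ofReal_toReal hT]
  have hmeas : ∀ r : ℝ, MeasurableSet (pball p r) := fun r =>
    measurableSet_lt (pnorm_measurable.comp (measurable_id.sub_const p)) measurable_const
  have hpt : ∀ y, ENNReal.ofReal (pnorm (p - y) ^ (-β)) ≤ (1 + 1) + ∑' k : ℕ,
      (pball p (2 * (1 / 2) ^ k)).indicator
        (fun _ => ENNReal.ofReal (((1 / 2 : ℝ) ^ (k + 1)) ^ (-β))) y := by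
    intro y
    set d := pnorm (p - y) with hd
    have hd0 : 0 ≤ d := pnorm_nonneg _
    rcases hd0.eq_or_lt with h0 | h0
    · rw [← h0]
      refine le_trans ?_ (le_self_add)
      refine le_trans ?_ (le_self_add)
      rw [ENNReal.ofReal_le_one]
      rcases hβ.eq_or_lt with h | h
      · simp [← h]
      · rw [Real.zero_rpow (by linarith)]; norm_num
    rcases le_or_gt 1 d with h1 | h1
    · refine le_trans ?_ (le_self_add)
      refine le_trans ?_ (le_self_add)
      rw [ENNReal.ofReal_le_one]
      exact Real.rpow_le_one_of_one_le_of_nonpos h1 (by linarith)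
    · obtain ⟨k, hk1, hk2⟩ := exists_nat_pow_near_of_lt_one h0 h1.le
        (by norm_num : (0:ℝ) < 1 / 2) (by norm_num)
      refine le_trans ?_ (le_add_self)
      refine le_trans ?_ (ENNReal.le_tsum k)
      have hmem : y ∈ pball p (2 * (1 / 2) ^ k) := by
        show pnorm (y - p) < _
        rw [pnorm_sub_comm, ← hd]
        have : (0:ℝ) < (1 / 2) ^ k := by positivity
        linarith
      rw [Set.indicator_of_mem hmem]
      apply ENNReal.ofReal_le_ofReal
      exact Real.rpow_le_rpow_of_nonpos (by positivity) hk1.le (by linarith)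
  refine (lintegral_mono hpt).trans ?_
  rw [lintegral_add_left measurable_const, lintegral_const, lintegral_tsum
    (fun k => (measurable_const.indicator (hmeas _)).aemeasurable), add_mul, one_mul]
  simp only [T, one_mul]
  refine add_le_add le_rfl (ENNReal.tsum_le_tsum fun k => ?_)
  rw [lintegral_indicator_const (hmeas _)]
  refine (mul_le_mul_right (hgrowth p _ (by positivity)) _).trans (le_of_eq ?_)
  rw [← ENNReal.ofReal_mul (by positivity)]
  congr 1
  have e1 : (1 / 2 : ℝ) ^ (k + 1) = (2:ℝ) ^ (-((k:ℝ) + 1)) := by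
    rw [Real.rpow_neg (by norm_num), one_div, inv_pow]
    congr 1
    exact_mod_cast (Real.rpow_natCast (2:ℝ) (k + 1)).symm
  have e2 : (2:ℝ) * (1 / 2) ^ k = (2:ℝ) ^ (1 - (k:ℝ)) := by
    rw [Real.rpow_sub (by norm_num), Real.rpow_one, Real.rpow_natCast, one_div, inv_pow]; rfl
  rw [e1, e2, ← Real.rpow_mul (by norm_num), ← Real.rpow_mul (by norm_num), ← Real.rpow_natCast,
    ← Real.rpow_mul (by norm_num), ← Real.rpow_add (by norm_num), ← Real.rpow_add (by norm_num),
    ← Real.rpow_add (by norm_num)]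
  congr 1; ring

lemma potential_integral {n : ℕ} (μ : Measure (Pt n)) (β M : ℝ) (hM : 0 ≤ M) (p : Pt n)
    (h : ∫⁻ y, ENNReal.ofReal (pnorm (p - y) ^ (-β)) ∂μ ≤ ENNReal.ofReal M) :
    Integrable (fun y => pnorm (p - y) ^ (-β)) μ ∧ ∫ y, pnorm (p - y) ^ (-β) ∂μ ≤ M := by
  have hm : Measurable (fun y : Pt n => pnorm (p - y) ^ (-β)) :=
    (pnorm_measurable.comp (measurable_const.sub measurable_id)).pow_const _
  have hnn : ∀ y : Pt n, 0 ≤ pnorm (p - y) ^ (-β) := fun y => Real.rpow_nonneg (pnorm_nonneg _) _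
  refine ⟨⟨hm.aestronglyMeasurable, ?_⟩, ?_⟩
  · rw [hasFiniteIntegral_iff_ofReal (Filter.Eventually.of_forall hnn)]
    exact h.trans_lt ENNReal.ofReal_lt_top
  · rw [integral_eq_lintegral_of_nonneg_ae (Filter.Eventually.of_forall hnn)
      hm.aestronglyMeasurable]
    exact ENNReal.toReal_le_of_le_ofReal hM h

lemma profile_integrable (α : ℝ) (hα : 1 / 2 < α) :
    Integrable (fun u : ℝ => min 1 (|u| ^ α) / |u| ^ (3 / 2 : ℝ)) := by
  have hpos : IntegrableOn (fun u : ℝ => min 1 (|u| ^ α) / |u| ^ (3 / 2 : ℝ)) (Ioi 0) := by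
    have hmeas : Measurable (fun u : ℝ => min 1 (|u| ^ α) / |u| ^ (3 / 2 : ℝ)) := by fun_prop
    rw [← Ioc_union_Ioi_eq_Ioi (zero_le_one : (0:ℝ) ≤ 1)]
    refine IntegrableOn.union ?_ ?_
    · have h1 : IntegrableOn (fun u : ℝ => u ^ (α - 3 / 2)) (Ioc 0 1) :=
        (intervalIntegrable_iff_integrableOn_Ioc_of_le zero_le_one).1
          (intervalIntegral.intervalIntegrable_rpow' (by linarith))
      refine Integrable.mono' h1 hmeas.aestronglyMeasurable ?_
      refine (ae_restrict_iff' measurableSet_Ioc).2 (Filter.Eventually.of_forall fun u hu => ?_)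
      have hu0 : 0 < u := hu.1
      rw [Real.norm_eq_abs, abs_of_nonneg (by positivity), abs_of_pos hu0, Real.rpow_sub hu0]
      gcongr
      exact min_le_right _ _
    · have h1 : IntegrableOn (fun u : ℝ => u ^ (-(3 / 2 : ℝ))) (Ioi 1) :=
        integrableOn_Ioi_rpow_of_lt (by norm_num) zero_lt_one
      refine Integrable.mono' h1 hmeas.aestronglyMeasurable ?_
      refine (ae_restrict_iff' measurableSet_Ioi).2 (Filter.Eventually.of_forall fun u hu => ?_)
      have hu0 : 0 < u := lt_trans zero_lt_one hu
      rw [Real.norm_eq_abs, abs_of_nonneg (by positivity), abs_of_pos hu0, Real.rpow_neg hu0.le,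
        ← one_div]
      gcongr
      exact min_le_left _ _
  have hneg : IntegrableOn (fun u : ℝ => min 1 (|u| ^ α) / |u| ^ (3 / 2 : ℝ)) (Iic 0) := by
    rw [← Measure.map_neg_eq_self (volume : Measure ℝ)]
    let m : MeasurableEmbedding fun x : ℝ => -x := (Homeomorph.neg ℝ).measurableEmbedding
    rw [m.integrableOn_map_iff]
    simp_rw [Function.comp_def, abs_neg, neg_preimage, neg_Iic, neg_zero]
    exact Iff.mpr integrableOn_Ici_iff_integrableOn_Ioi hpos
  rw [← integrableOn_univ, ← Iic_union_Ioi (a := (0:ℝ))]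
  exact hneg.union hpos

lemma average_bound {X : Type*} [MeasurableSpace X] (ν : Measure X) (g : X → ℝ) (K : ℝ)
    (hK : 0 ≤ K) (hg : ∀ x, |g x| ≤ K) : |⨍ x, g x ∂ν| ≤ K := by
  rw [average_eq, smul_eq_mul, abs_mul, abs_of_nonneg (by positivity)]
  rcases eq_or_ne (ν.real univ) 0 with h | h
  · rw [h]; simpa using hK
  · have hlt : ν univ < ⊤ := by
      by_contra hh
      apply h
      rw [not_lt, top_le_iff] at hh
      simp [Measure.real, hh]
    have : IsFiniteMeasure ν := ⟨hlt⟩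
    have h1 := norm_integral_le_of_norm_le_const (μ := ν) (f := g) (C := K)
      (Filter.Eventually.of_forall hg)
    have h2 : 0 < ν.real univ := lt_of_le_of_ne measureReal_nonneg h.symm
    rw [inv_mul_le_iff₀ h2]
    rw [Real.norm_eq_abs] at h1
    linarith

lemma bmo_of_bound {n : ℕ} (f : Pt n → ℝ) (K : ℝ) (hK : 0 ≤ K) (hf : ∀ p, |f p| ≤ K) :
    ParabBMOLe f (2 * K) := by
  intro Q
  have h1 := average_bound (volume.restrict Q.toSet) f K hK hf
  refine (le_abs_self _).trans (average_bound (volume.restrict Q.toSet) _ (2 * K) (by linarith) ?_)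
  intro p
  rw [abs_abs]
  refine (abs_sub _ _).trans ?_
  linarith [hf p]

lemma main_bounds {n : ℕ} (s : ℝ) (hs : (n : ℝ) + 1 < s) (μ : Measure (Pt n)) [IsFiniteMeasure μ]
    (hgrowth : ∀ (c : Pt n) (r : ℝ), 0 < r → μ (pball c r) ≤ ENNReal.ofReal (r ^ s)) :
    ∃ K : ℝ, 0 < K ∧ (∀ p, ‖mconvGradW μ p‖ ≤ K) ∧ ∀ p, |halfT (mconvW μ) p| ≤ K := by
  have hn0 : (0:ℝ) ≤ n := by positivity
  -- exponent
  set ε := min (s - n - 1) 1 / 4 with hε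
  have hmin : 0 < min (s - n - 1) 1 := lt_min (by linarith) one_pos
  have hm1 := min_le_left (s - n - 1) 1
  have hm2 := min_le_right (s - n - 1) 1
  set α := 1 / 2 + ε with hα
  have hα1 : 1 / 2 < α := by linarith
  have hα2 : α < 1 := by linarith
  have hαs : (n : ℝ) + 2 * α < s := by linarith
  obtain ⟨G, hG, hG'⟩ := gradW_le (n := n)
  obtain ⟨A, hA, hA'⟩ := heatW_le (n := n) 0 le_rfl
  obtain ⟨H, hH, hH'⟩ := heatW_hol (n := n) α (by linarith) hα2
  obtain ⟨M1, hM1, hM1'⟩ := potential_bound s μ hgrowth ((n : ℝ) + 1) (by linarith) hs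
  obtain ⟨M0, hM0, hM0'⟩ := potential_bound s μ hgrowth (n : ℝ) (by linarith) (by linarith)
  obtain ⟨M2, hM2, hM2'⟩ := potential_bound s μ hgrowth ((n : ℝ) + 2 * α) (by linarith) hαs
  have hWle : ∀ p : Pt n, heatW p ≤ A * pnorm p ^ (-(n : ℝ)) := by
    intro p
    rcases le_or_gt p.2 0 with h | h
    · have e : heatW p = 0 := by simp [heatW, not_lt.2 h]
      have := pnorm_nonneg p
      rw [e]; positivity
    · simpa using hA' p h
  have hWint : ∀ p : Pt n, Integrable (fun y => heatW (p - y)) μ := by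
    intro p
    refine Integrable.mono' ((potential_integral μ _ M0 hM0 p (hM0' p)).1.const_mul A)
      (heatW_measurable.comp (measurable_const.sub measurable_id)).aestronglyMeasurable
      (Filter.Eventually.of_forall fun y => ?_)
    rw [Real.norm_eq_abs, abs_of_nonneg (heatW_nonneg _)]
    exact hWle _
  have hWb : ∀ p : Pt n, |mconvW μ p| ≤ A * M0 := by
    intro p
    obtain ⟨i1, i2⟩ := potential_integral μ _ M0 hM0 p (hM0' p)
    unfold mconvW
    rw [abs_of_nonneg (integral_nonneg fun y => heatW_nonneg _)]
    refine (integral_mono (hWint p) (i1.const_mul A) (fun y => hWle _)).trans ?_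
    rw [integral_const_mul]
    gcongr
  have hWh : ∀ (x : Spc n) (t t' : ℝ), |mconvW μ (x, t) - mconvW μ (x, t')| ≤
      H * (2 * M2) * |t - t'| ^ α := by
    intro x t t'
    obtain ⟨i1, i2⟩ := potential_integral μ _ M2 hM2 (x, t) (hM2' (x, t))
    obtain ⟨j1, j2⟩ := potential_integral μ _ M2 hM2 (x, t') (hM2' (x, t'))
    unfold mconvW
    rw [← integral_sub (hWint _) (hWint _)]
    have hb := norm_integral_le_of_norm_le (((i1.add j1).const_mul (|t - t'| ^ α)).const_mul H)
      (f := fun y => heatW ((x, t) - y) - heatW ((x, t') - y)) (μ := μ)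
      (Filter.Eventually.of_forall fun y => by
        have := hH' (x - y.1) (t - y.2) (t' - y.2)
        rw [sub_sub_sub_cancel_right] at this
        exact this)
    rw [Real.norm_eq_abs] at hb
    refine hb.trans ?_
    rw [integral_const_mul, integral_const_mul]
    rw [integral_add' i1 j1]
    calc _ ≤ H * (|t - t'| ^ α * (2 * M2)) := by
          gcongr
          linarith
      _ = _ := by ring
  set L := 2 * (A * M0) + H * (2 * M2) with hL
  have hL0 : 0 ≤ L := by positivity
  have hdiff : ∀ (x : Spc n) (t t' : ℝ), |mconvW μ (x, t) - mconvW μ (x, t')| ≤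
      L * min 1 (|t - t'| ^ α) := by
    intro x t t'
    have k1 : 0 ≤ A * M0 := by positivity
    have k2 : 0 ≤ H * (2 * M2) := by positivity
    rcases min_cases 1 (|t - t'| ^ α) with ⟨h, _⟩ | ⟨h, _⟩
    · rw [h]
      refine (abs_sub _ _).trans ?_
      linarith [hWb (x, t), hWb (x, t')]
    · rw [h]
      refine (hWh x t t').trans ?_
      gcongr
      linarith
  set P := ∫ u : ℝ, min 1 (|u| ^ α) / |u| ^ (3 / 2 : ℝ) with hP
  have hP0 : 0 ≤ P := integral_nonneg fun u => by positivity
  refine ⟨G * M1 + L * P + 1, by positivity, fun p => ?_, fun p => ?_⟩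
  · obtain ⟨i1, i2⟩ := potential_integral μ _ M1 hM1 p (hM1' p)
    have hb := norm_integral_le_of_norm_le (i1.const_mul G) (f := fun y => gradW (p - y)) (μ := μ)
      (Filter.Eventually.of_forall fun y => hG' _)
    rw [integral_const_mul] at hb
    have : G * ∫ y, pnorm (p - y) ^ (-((n : ℝ) + 1)) ∂μ ≤ G * M1 := by gcongr
    have h3 : 0 ≤ L * P := by positivity
    unfold mconvGradW
    linarith
  · have hI := ((profile_integrable α hα1).comp_sub_right p.2).const_mul L
    have hb := norm_integral_le_of_norm_le hI
      (f := fun u => (mconvW μ (p.1, u) - mconvW μ p) / |u - p.2| ^ (3 / 2 : ℝ))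
      (Filter.Eventually.of_forall fun u => by
        rw [Real.norm_eq_abs, abs_div, abs_of_nonneg (by positivity : 0 ≤ |u - p.2| ^ (3 / 2 : ℝ)),
          ← mul_div_assoc]
        gcongr
        exact hdiff p.1 u p.2)
    rw [integral_const_mul,
      integral_sub_right_eq_self (fun u : ℝ => min 1 (|u| ^ α) / |u| ^ (3 / 2 : ℝ)) p.2] at hb
    rw [Real.norm_eq_abs] at hb
    unfold halfT
    have h3 : 0 ≤ G * M1 := by positivity
    linarith

/-- a compact set carrying a nonzero measure with growth `r^s`, `s > n+1`,
has positive capacity `γ_{Θ,+}`: there is a nonzero admissible positive measure on `E`. -/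
theorem pos_capacity_of_growth (n : ℕ) (hn : 1 ≤ n) (s : ℝ) (hs : (n : ℝ) + 1 < s)
    (E : Set (Pt n)) (hE : IsCompact E) (μ : Measure (Pt n)) (hfin : IsFiniteMeasure μ)
    (hne : μ ≠ 0) (hsupp : μ Eᶜ = 0)
    (hgrowth : ∀ (c : Pt n) (r : ℝ), 0 < r → μ (pball c r) ≤ ENNReal.ofReal (r ^ s)) :
    ∃ ν : Measure (Pt n), ν ≠ 0 ∧ ν Eᶜ = 0 ∧ IsFiniteMeasure ν ∧
      (∀ p, ‖mconvGradW ν p‖ ≤ 1) ∧ ParabBMOLe (halfT (mconvW ν)) 1 := by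
  obtain ⟨K, hK, h1, h2⟩ := main_bounds s hs μ hgrowth
  set c : ℝ := 1 / (2 * K) with hc
  have hc0 : 0 < c := by positivity
  have hcK : c * K = 1 / 2 := by rw [hc]; field_simp
  refine ⟨ENNReal.ofReal c • μ, ?_, ?_, ?_, ?_, ?_⟩
  · intro h
    apply hne
    rw [← Measure.measure_univ_eq_zero] at h ⊢
    rw [Measure.smul_apply, smul_eq_mul, mul_eq_zero] at h
    rcases h with h | h
    · exact absurd (ENNReal.ofReal_eq_zero.1 h) (not_le.2 hc0)
    · exact h
  · rw [Measure.smul_apply, hsupp, smul_zero]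
  · exact ⟨by
      rw [Measure.smul_apply, smul_eq_mul]
      exact ENNReal.mul_lt_top ENNReal.ofReal_lt_top (measure_lt_top μ _)⟩
  · intro p
    have e : mconvGradW (ENNReal.ofReal c • μ) p = c • mconvGradW μ p := by
      unfold mconvGradW
      rw [integral_smul_measure, ENNReal.toReal_ofReal hc0.le]
    rw [e, norm_smul, Real.norm_eq_abs, abs_of_pos hc0]
    have := mul_le_mul_of_nonneg_left (h1 p) hc0.le
    linarith
  · have hb := bmo_of_bound (halfT (mconvW (ENNReal.ofReal c • μ))) (1 / 2) (by norm_num) ?_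
    · simpa using hb
    intro p
    have e : ∀ q, mconvW (ENNReal.ofReal c • μ) q = c * mconvW μ q := by
      intro q
      unfold mconvW
      rw [integral_smul_measure, ENNReal.toReal_ofReal hc0.le, smul_eq_mul]
    have e2 : halfT (mconvW (ENNReal.ofReal c • μ)) p = c * halfT (mconvW μ) p := by
      unfold halfT
      rw [← integral_const_mul]
      congr 1
      funext u
      rw [e, e]
      ring
    rw [e2, abs_mul, abs_of_pos hc0]
    have := mul_le_mul_of_nonneg_left (h2 p) hc0.le
    linarith
end
end
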